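/- Pseudo-Ordered Principle (Theorem A, first part): Let Φ be a semiflow on X strongly focusing monotone with respect to the k-cone C, satisfying the standing assumptions. If O⁺(x) is a precompact pseudo-ordered semiorbit, then the ω-limit set ω(x) is ordered, i.e. y − z ∈ C for all y, z ∈ ω(x). -/

import Mathlib

open Set Metric Filter

/-- A semiflow on `X`: continuous on `[0,∞) × X`, `Φ₀ = id`, `Φ_{s+t} = Φ_s ∘ Φ_t`. -/
structure Semiflow (X : Type*) [NormedAddCommGroup X] [NormedSpace ℝ X] where
  toFun : ℝ → X → X
  cont : ContinuousOn (fun p : ℝ × X => toFun p.1 p.2) (Set.Ici (0:ℝ) ×ˢ Set.univ)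
  map_zero : ∀ x, toFun 0 x = x
  map_add : ∀ s t : ℝ, 0 ≤ s → 0 ≤ t → ∀ x, toFun (s + t) x = toFun s (toFun t x)

section Defs

variable {X : Type*} [NormedAddCommGroup X] [NormedSpace ℝ X]

/-- A cone of rank `k`: a closed set, stable under all real scalings, containing a
`k`-dimensional subspace and no subspace of higher dimension. -/
def IsKCone (C : Set X) (k : ℕ) : Prop :=
  IsClosed C ∧ (∀ (t : ℝ) (v : X), v ∈ C → t • v ∈ C) ∧
  (∃ W : Submodule ℝ X, (W : Set X) ⊆ C ∧ Module.rank ℝ W = k) ∧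
  (∀ W : Submodule ℝ X, (W : Set X) ⊆ C → Module.rank ℝ W ≤ k)

/-- `C` is `k`-solid: some `k`-dimensional subspace `W` has `W \ {0} ⊆ int C`. -/
def IsKSolid (C : Set X) (k : ℕ) : Prop :=
  ∃ W : Submodule ℝ X, Module.rank ℝ W = k ∧ ((W : Set X) \ {0}) ⊆ interior C

/-- `C` is complemented: some closed subspace of codimension `k` meets `C` only at `0`. -/
def IsComplementedCone (C : Set X) (k : ℕ) : Prop :=
  ∃ H : Submodule ℝ X, IsClosed (H : Set X) ∧ Module.rank ℝ (X ⧸ H) = k ∧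
    (H : Set X) ∩ C = {0}

/-- The positive semiorbit `O⁺(x)`. -/
def posOrbit (Φ : Semiflow X) (x : X) : Set X := {y | ∃ t, 0 ≤ t ∧ y = Φ.toFun t x}

/-- The ω-limit set `ω(x) = ⋂_{s ≥ 0} cl {Φ_t(x) : t ≥ s}`. -/
def omegaSet (Φ : Semiflow X) (x : X) : Set X :=
  ⋂ s ∈ Set.Ici (0:ℝ), closure {y | ∃ t, s ≤ t ∧ y = Φ.toFun t x}

/-- The set of equilibria of `Φ`. -/
def equilibria (Φ : Semiflow X) : Set X := {p | ∀ t, 0 ≤ t → Φ.toFun t p = p}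

/-- `S` is invariant: `Φ_t(S) = S` for all `t ≥ 0`. -/
def Invariant (Φ : Semiflow X) (S : Set X) : Prop := ∀ t, 0 ≤ t → Φ.toFun t '' S = S

/-- A set is ordered w.r.t. `C` if any two of its points are ordered. -/
def OrderedSet (C S : Set X) : Prop := ∀ x ∈ S, ∀ y ∈ S, x - y ∈ C

/-- A set is unordered w.r.t. `C` if it is not a singleton and any two distinct points are
unordered. -/
def UnorderedSet (C S : Set X) : Prop :=
  (¬ ∃ a, S = {a}) ∧ ∀ x ∈ S, ∀ y ∈ S, x ≠ y → x - y ∉ C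

/-- Two sets `A ∼ B`: every point of `A` is ordered with every point of `B`. -/
def SetsOrdered (C A B : Set X) : Prop := ∀ a ∈ A, ∀ b ∈ B, a - b ∈ C

/-- `Φ` is strongly monotone with respect to the cone `C`. -/
def StronglyMonotone (Φ : Semiflow X) (C : Set X) : Prop :=
  (∀ t, 0 ≤ t → ∀ x y : X, x - y ∈ C → Φ.toFun t x - Φ.toFun t y ∈ C) ∧
  (∀ t, 0 < t → ∀ x y : X, x - y ∈ C → x ≠ y → Φ.toFun t x - Φ.toFun t y ∈ interior C)

/-- `O⁺(x)` is pseudo-ordered. -/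
def PseudoOrdered (Φ : Semiflow X) (C : Set X) (x : X) : Prop :=
  ∃ t₁ t₂ : ℝ, 0 ≤ t₁ ∧ 0 ≤ t₂ ∧ Φ.toFun t₁ x ≠ Φ.toFun t₂ x ∧
    Φ.toFun t₁ x - Φ.toFun t₂ x ∈ C

/-- A bounded operator `R` is strongly focusing w.r.t. `C` with separation index `κ`:
`0 ∉ R(C \ {0})` and every unit vector of `RC` is at distance at least `κ` from `X \ C`. -/
def StronglyFocusing (R : X →L[ℝ] X) (C : Set X) (κ : ℝ) : Prop :=
  (∀ v ∈ C, v ≠ 0 → R v ≠ 0) ∧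
  (∀ v ∈ R '' C, ‖v‖ = 1 → ∀ u ∉ C, κ ≤ ‖v - u‖)

/-- `Φ` is strongly focusing monotone with respect to `C`, with `x`-derivative `DΦ`. -/
def StronglyFocusingMonotone (Φ : Semiflow X) (DΦ : ℝ → X → X →L[ℝ] X) (C : Set X) : Prop :=
  (∀ t, 0 ≤ t → ∀ x : X, HasFDerivAt (Φ.toFun t) (DΦ t x) x) ∧
  (∀ t, 0 ≤ t → Continuous fun x : X => DΦ t x) ∧
  StronglyMonotone Φ C ∧
  (∀ t, 0 < t → ∀ x : X, ∀ v ∈ C, v ≠ 0 → DΦ t x v ∈ interior C) ∧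
  (∀ S : Set X, IsCompact S → Invariant Φ S →
    ∃ δ > (0:ℝ), ∃ T > (0:ℝ), ∃ κ > (0:ℝ), ∀ z ∈ S, ∀ x ∈ Metric.closedBall z δ,
      ∀ y ∈ Metric.closedBall z δ, ∃ R : X →L[ℝ] X,
        StronglyFocusing R C κ ∧ R (x - y) = Φ.toFun T x - Φ.toFun T y)

/-- `ψ` is a flow extension of `Φ` on the invariant set `S`. -/
def IsFlowExtensionOn (Φ : Semiflow X) (ψ : ℝ → X → X) (S : Set X) : Prop :=
  (∀ t, 0 ≤ t → ∀ z ∈ S, ψ t z = Φ.toFun t z) ∧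
  (∀ t : ℝ, ∀ z ∈ S, ψ t z ∈ S) ∧
  (∀ s t : ℝ, ∀ z ∈ S, ψ s (ψ t z) = ψ (s + t) z) ∧
  ContinuousOn (fun p : ℝ × X => ψ p.1 p.2) (Set.univ ×ˢ S)

/-- `Φ` admits a flow extension on each ω-limit set. -/
def AdmitsFlowExtensions (Φ : Semiflow X) : Prop :=
  ∀ x : X, ∃ ψ : ℝ → X → X, IsFlowExtensionOn Φ ψ (omegaSet Φ x)

/-- The α-limit set of `z` along the (extended) flow `ψ`. -/
def alphaSet (ψ : ℝ → X → X) (z : X) : Set X :=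
  ⋂ s ∈ Set.Ici (0:ℝ), closure {y | ∃ t, s ≤ t ∧ y = ψ (-t) z}

/-- Standing assumptions: `C` is a complemented `k`-solid `k`-cone, the derivative
`D_xΦ_t` is a compact operator for all `x` and `t > 0`, and `Φ` admits a flow extension on
each ω-limit set. -/
def StandingAssumptions (Φ : Semiflow X) (DΦ : ℝ → X → X →L[ℝ] X)
    (C : Set X) (k : ℕ) : Prop :=
  IsKCone C k ∧ IsKSolid C k ∧ IsComplementedCone C k ∧
  (∀ t, 0 < t → ∀ x : X, IsCompactOperator ⇑(DΦ t x)) ∧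
  AdmitsFlowExtensions Φ

end Defs

section Cone

variable {X : Type*} [NormedAddCommGroup X]

/-- The vectors whose distance to the complement of `C` is at least `κ` times their norm. -/
def deepCone (C : Set X) (κ : ℝ) : Set X := {w | ∀ u, u ∉ C → κ * ‖w‖ ≤ ‖w - u‖}

theorem deepCone_subset {C : Set X} {κ : ℝ} (hκ : 0 < κ) (h0 : (0 : X) ∈ C) :
    deepCone C κ ⊆ C := by
  intro w hw
  by_contra h
  have h1 := hw w h
  rw [sub_self, norm_zero] at h1
  have h2 : ‖w‖ = 0 := le_antisymm (by nlinarith [norm_nonneg w]) (norm_nonneg w)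
  exact h (by rwa [norm_eq_zero.1 h2])

theorem isClosed_deepCone (C : Set X) (κ : ℝ) : IsClosed (deepCone C κ) := by
  have : deepCone C κ = ⋂ u ∈ Cᶜ, {w | κ * ‖w‖ ≤ ‖w - u‖} := by
    ext w; simp [deepCone]
  rw [this]
  exact isClosed_biInter fun u _ => isClosed_le (by fun_prop) (by fun_prop)

variable [NormedSpace ℝ X]

theorem cone_neg_mem {C : Set X} (hsc : ∀ (t : ℝ) (v : X), v ∈ C → t • v ∈ C) {v : X}
    (hv : v ∈ C) : -v ∈ C := by
  simpa using hsc (-1) v hv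

theorem cone_sub_comm {C : Set X} (hsc : ∀ (t : ℝ) (v : X), v ∈ C → t • v ∈ C) {a b : X}
    (h : a - b ∈ C) : b - a ∈ C := by
  simpa using cone_neg_mem hsc h

theorem cone_smul_mem_iff {C : Set X} (hsc : ∀ (t : ℝ) (v : X), v ∈ C → t • v ∈ C) {t : ℝ}
    (ht : t ≠ 0) {v : X} : t • v ∈ C ↔ v ∈ C := by
  refine ⟨fun h => ?_, hsc t v⟩
  simpa [smul_smul, ht] using hsc t⁻¹ _ h

theorem smul_mem_deepCone {C : Set X} (hsc : ∀ (t : ℝ) (v : X), v ∈ C → t • v ∈ C) {κ : ℝ}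
    {w : X} (hw : w ∈ deepCone C κ) (t : ℝ) : t • w ∈ deepCone C κ := by
  intro u hu
  rcases eq_or_ne t 0 with rfl | ht
  · simp
  · have h := hw (t⁻¹ • u) (fun h => hu ((cone_smul_mem_iff hsc (inv_ne_zero ht)).1 h))
    have h2 : t • w - u = t • (w - t⁻¹ • u) := by
      rw [smul_sub, smul_smul, mul_inv_cancel₀ ht, one_smul]
    rw [h2, norm_smul, norm_smul]
    nlinarith [norm_nonneg t]

theorem StronglyFocusing.map_mem_deepCone {C : Set X} {κ : ℝ} {R : X →L[ℝ] X}
    (hsc : ∀ (t : ℝ) (v : X), v ∈ C → t • v ∈ C) (hR : StronglyFocusing R C κ) {v : X}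
    (hv : v ∈ C) : R v ∈ deepCone C κ := by
  rcases eq_or_ne (R v) 0 with h | h
  · intro u _; simp [h]
  have hn : ‖R v‖ ≠ 0 := norm_ne_zero_iff.2 h
  have h1 : ‖R v‖⁻¹ • R v ∈ deepCone C κ := by
    have hnorm : ‖‖R v‖⁻¹ • R v‖ = 1 := by rw [norm_smul, norm_inv, norm_norm, inv_mul_cancel₀ hn]
    intro u hu
    rw [hnorm, mul_one]
    exact hR.2 _ ⟨‖R v‖⁻¹ • v, hsc _ _ hv, by simp⟩ hnorm u hu
  simpa [smul_smul, hn] using smul_mem_deepCone hsc h1 ‖R v‖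

/-- For a product of operators focusing the cone into `deepCone C κ`, vectors in the deep cone
grow exponentially faster than vectors that stay outside the cone. -/
theorem exists_linear_ratio_growth {C : Set X} (hsc : ∀ (t : ℝ) (v : X), v ∈ C → t • v ∈ C)
    (h0 : (0 : X) ∈ C) {κ : ℝ} (hκ : 0 < κ) : ∃ l > (0 : ℝ), ∃ c > (0 : ℝ),
    ∀ (L : ℕ → X →L[ℝ] X), (∀ i, ∀ v ∈ C, L i v ∈ deepCone C κ) →
    ∀ w v : ℕ → X, (∀ i, w (i + 1) = L i (w i)) → (∀ i, v (i + 1) = L i (v i)) →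
    w 0 ∈ deepCone C κ → ∀ n, v (n + 1) ∉ C →
      c * (1 + l) ^ n * (‖w 0‖ * ‖v (n + 1)‖) ≤ ‖v 0‖ * ‖w (n + 1)‖ := by
  refine ⟨κ ^ 3 / (2 * (1 + κ)), by positivity, κ ^ 2 / (2 * (1 + κ)), by positivity, ?_⟩
  set l : ℝ := κ ^ 3 / (2 * (1 + κ)) with hl
  have hlpos : 0 < l := by positivity
  have hl2 : l * (1 + κ) = κ ^ 3 / 2 := by rw [hl]; field_simp
  intro L hL w v hw hv hw0 n hn
  rcases eq_or_ne (w 0) 0 with hz | hz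
  · rw [hz]; simp; positivity
  have hwpos : 0 < ‖w 0‖ := norm_pos_iff.2 hz
  have hsub := deepCone_subset hκ h0
  have hvC : ∀ i, v (i + 1) ∉ C → v i ∉ C := fun i h h' => h (by
    rw [hv]; exact hsub (hL i _ h'))
  have hvC0 : ∀ i, v i ∉ C → v 0 ∉ C := by
    intro i
    induction i with
    | zero => exact id
    | succ i ih => exact fun h => ih (hvC i h)
  have hv0 : 0 < ‖v 0‖ := norm_pos_iff.2 fun h => hvC0 _ hn (by rwa [h])
  have key : ∀ s : ℝ, 0 < s → ∀ i, v (i + 1) ∉ C → (∀ r, |r| ≤ s → w i + r • v i ∈ C) →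
      s * ‖v (i + 1)‖ * κ ≤ (1 + κ) * ‖w (i + 1)‖ ∧
      ∀ r, |r| ≤ (1 + l) * s → w (i + 1) + r • v (i + 1) ∈ C := by
    intro s hs i hi h
    have hdeep : ∀ r, |r| ≤ s → w (i + 1) + r • v (i + 1) ∈ deepCone C κ := by
      intro r hr
      have := hL i _ (h r hr)
      rwa [map_add, map_smul, ← hw, ← hv] at this
    have hwd : w (i + 1) ∈ deepCone C κ := by simpa using hdeep 0 (by simpa using hs.le)
    have hout : ∀ r : ℝ, r ≠ 0 → r • v (i + 1) ∉ C := fun r hr h =>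
      hi ((cone_smul_mem_iff hsc hr).1 h)
    have hle : ∀ r, |r| ≤ s → κ * ‖w (i + 1)‖ ≤ ‖w (i + 1) + r • v (i + 1)‖ ∨ r = 0 := by
      intro r hr
      rcases eq_or_ne r 0 with h0 | h0
      · exact Or.inr h0
      · left
        simpa using hwd ((-r) • v (i + 1)) (hout _ (neg_ne_zero.2 h0))
    have hfirst : s * ‖v (i + 1)‖ * κ ≤ (1 + κ) * ‖w (i + 1)‖ := by
      have h1 := hdeep s (by rw [abs_of_pos hs]) (s • v (i + 1)) (hout s hs.ne')
      rw [add_sub_cancel_right] at h1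
      have h2 : s * ‖v (i + 1)‖ ≤ ‖w (i + 1) + s • v (i + 1)‖ + ‖w (i + 1)‖ := by
        have : s • v (i + 1) = (w (i + 1) + s • v (i + 1)) - w (i + 1) := by abel
        calc s * ‖v (i + 1)‖ = ‖s • v (i + 1)‖ := by rw [norm_smul, Real.norm_of_nonneg hs.le]
          _ = ‖(w (i + 1) + s • v (i + 1)) - w (i + 1)‖ := by rw [← this]
          _ ≤ _ := norm_sub_le _ _
      nlinarith
    refine ⟨hfirst, fun r hr => ?_⟩
    have h1l : 0 < 1 + l := by positivity
    set r' := r / (1 + l) with hr'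
    have hrr : r = r' + l * r' := by rw [hr']; field_simp
    have hr's : |r'| ≤ s := by
      rw [hr', abs_div, abs_of_pos h1l, div_le_iff₀ h1l]; linarith
    by_contra hcon
    have h1 := hdeep r' hr's _ hcon
    have h2 : ‖w (i + 1) + r' • v (i + 1) - (w (i + 1) + r • v (i + 1))‖
        = l * |r'| * ‖v (i + 1)‖ := by
      have : w (i + 1) + r' • v (i + 1) - (w (i + 1) + r • v (i + 1))
          = (-(l * r')) • v (i + 1) := by rw [hrr]; module
      rw [this, norm_smul, norm_neg, norm_mul, Real.norm_of_nonneg hlpos.le, Real.norm_eq_abs]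
    rw [h2] at h1
    have hr0 : r' ≠ 0 := by
      intro h
      rw [hrr, h] at hcon
      exact hcon (by simpa using hsub hwd)
    have h3 := (hle r' hr's).resolve_right hr0
    have h4 : 0 < ‖v (i + 1)‖ := norm_pos_iff.2 fun h => hi (by rwa [h])
    have h5 : 0 < ‖w (i + 1)‖ := by
      have : 0 < s * ‖v (i + 1)‖ * κ := by positivity
      by_contra hneg
      nlinarith [norm_nonneg (w (i + 1))]
    have h6 : l * |r'| * ‖v (i + 1)‖ ≤ l * (s * ‖v (i + 1)‖) := by
      rw [mul_assoc]; gcongr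
    have h7 : κ * (κ * ‖w (i + 1)‖) ≤ l * (s * ‖v (i + 1)‖) := by nlinarith
    have h8 : l * (s * ‖v (i + 1)‖) * κ ≤ κ ^ 3 / 2 * ‖w (i + 1)‖ := by
      rw [← hl2]; nlinarith
    have h9 : κ ^ 3 * ‖w (i + 1)‖ ≤ κ ^ 3 / 2 * ‖w (i + 1)‖ := by nlinarith
    have : 0 < κ ^ 3 * ‖w (i + 1)‖ := by positivity
    linarith
  set s0 : ℝ := κ * ‖w 0‖ / (2 * ‖v 0‖) with hs0
  have hs0pos : 0 < s0 := by positivity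
  have hind : ∀ i, v i ∉ C → ∀ r, |r| ≤ (1 + l) ^ i * s0 → w i + r • v i ∈ C := by
    intro i
    induction i with
    | zero =>
      intro _ r hr
      by_contra hcon
      have h1 := hw0 _ hcon
      rw [sub_add_cancel_left, norm_neg, norm_smul, Real.norm_eq_abs] at h1
      have h2 : |r| * ‖v 0‖ ≤ s0 * ‖v 0‖ := by
        rw [pow_zero, one_mul] at hr
        gcongr
      have h3 : s0 * ‖v 0‖ = κ * ‖w 0‖ / 2 := by rw [hs0]; field_simp
      have : 0 < κ * ‖w 0‖ := by positivity
      linarith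
    | succ i ih =>
      intro hi r hr
      refine (key _ (by positivity) i hi (ih (hvC i hi))).2 r ?_
      rw [pow_succ] at hr
      linarith
  have hfin := (key _ (by positivity) n hn (hind n (hvC n hn))).1
  have h3 : s0 * ‖v 0‖ = κ * ‖w 0‖ / 2 := by rw [hs0]; field_simp
  have h4 : κ ^ 2 / (2 * (1 + κ)) * (1 + l) ^ n * (‖w 0‖ * ‖v (n + 1)‖) * (1 + κ)
      = ((1 + l) ^ n * s0 * ‖v (n + 1)‖ * κ) * ‖v 0‖ := by
    have : κ ^ 2 / (2 * (1 + κ)) * (1 + l) ^ n * (‖w 0‖ * ‖v (n + 1)‖) * (1 + κ)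
      = (1 + l) ^ n * ‖v (n + 1)‖ * κ * (κ * ‖w 0‖ / 2) := by field_simp
    rw [this, ← h3]; ring
  have h5 : ((1 + l) ^ n * s0 * ‖v (n + 1)‖ * κ) * ‖v 0‖ ≤ (1 + κ) * ‖w (n + 1)‖ * ‖v 0‖ := by
    gcongr
  have h6 : 0 < 1 + κ := by positivity
  rw [← h4] at h5
  nlinarith

end Cone


section Linearization

variable {X : Type*} [NormedAddCommGroup X] [NormedSpace ℝ X]

/-- A `C¹` map is uniformly strictly differentiable along a compact set. -/
theorem IsCompact.exists_uniform_strict_fderiv {S : Set X} (hS : IsCompact S) {f : X → X}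
    {f' : X → X →L[ℝ] X} (hf : ∀ y, HasFDerivAt f (f' y) y) (hf' : Continuous f') {η : ℝ}
    (hη : 0 < η) : ∃ ε > (0 : ℝ), ∀ e ∈ S, ∀ a ∈ closedBall e ε, ∀ b ∈ closedBall e ε,
      ‖f a - f b - f' e (a - b)‖ ≤ η * ‖a - b‖ := by
  have h := hS.uniformContinuousAt_of_continuousAt f' (fun a _ => hf'.continuousAt)
    (Metric.dist_mem_uniformity hη)
  obtain ⟨ε, hε, h⟩ := Metric.mem_uniformity_dist.1 h
  refine ⟨ε / 2, by positivity, fun e he a ha b hb => ?_⟩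
  refine Convex.norm_image_sub_le_of_norm_hasFDerivWithin_le' (f' := f')
    (fun y _ => (hf y).hasFDerivWithinAt) (fun y hy => ?_) (convex_closedBall e (ε / 2)) hb ha
  have h1 : dist e y < ε := by
    rw [dist_comm]; exact lt_of_le_of_lt (mem_closedBall.1 hy) (by linarith)
  have h2 : dist (f' e) (f' y) < η := h h1 he
  rw [← dist_eq_norm, dist_comm]
  exact h2.le

/-- A continuous family of operators that are positive with respect to a solid cone of
maximal rank is bounded below on the deep cone, uniformly over compact sets. -/
theorem exists_lower_bound_deepCone {C : Set X} {k : ℕ}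
    (h0 : (0 : X) ∈ C) (hcl : IsClosed C) (hsc : ∀ (t : ℝ) (v : X), v ∈ C → t • v ∈ C)
    (hmax : ∀ W : Submodule ℝ X, (W : Set X) ⊆ C → Module.rank ℝ W ≤ k)
    (hsolid : IsKSolid C k) (hint : (0 : X) ∉ interior C) {κ : ℝ} (hκ : 0 < κ)
    {S : Set X} (hS : IsCompact S) {L : X → X →L[ℝ] X} (hLc : Continuous L)
    (hL : ∀ e, ∀ v ∈ C, v ≠ 0 → L e v ∈ interior C) :
    ∃ m > (0 : ℝ), ∀ e ∈ S, ∀ w ∈ deepCone C κ, m * ‖w‖ ≤ ‖L e w‖ := by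
  have hsub := deepCone_subset hκ h0
  by_contra! hcon
  have hseq : ∀ n : ℕ, ∃ e ∈ S, ∃ w ∈ deepCone C κ, ‖w‖ = 1 ∧ ‖L e w‖ ≤ 1 / ((n : ℝ) + 1) := by
    intro n
    obtain ⟨e, he, w, hw, hlt⟩ := hcon (1 / ((n : ℝ) + 1)) (by positivity)
    have hw0 : 0 < ‖w‖ := by
      rw [norm_pos_iff]; rintro rfl; simp at hlt
    refine ⟨e, he, ‖w‖⁻¹ • w, smul_mem_deepCone hsc hw _, ?_, ?_⟩
    · rw [norm_smul, norm_inv, norm_norm, inv_mul_cancel₀ hw0.ne']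
    · rw [map_smul, norm_smul, norm_inv, norm_norm, inv_mul_le_iff₀ hw0, mul_comm]
      exact hlt.le
  choose e he w hw hw1 hLw using hseq
  obtain ⟨p, -, φ, hφ, hlim⟩ := hS.tendsto_subseq he
  have hLlim : Tendsto (fun n => L (e (φ n))) atTop (nhds (L p)) :=
    (hLc.tendsto p).comp hlim
  have hone : Tendsto (fun n : ℕ => 1 / ((φ n : ℝ) + 1)) atTop (nhds 0) :=
    (tendsto_one_div_add_atTop_nhds_zero_nat (𝕜 := ℝ)).comp hφ.tendsto_atTop
  have hz : Tendsto (fun n => L (e (φ n)) (w (φ n))) atTop (nhds 0) :=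
    squeeze_zero_norm (fun n => hLw (φ n)) hone
  have hmapC : ∀ e, ∀ v ∈ C, L e v ∈ C := by
    intro e v hv
    rcases eq_or_ne v 0 with rfl | h
    · simpa using h0
    · exact interior_subset (hL e v hv h)
  have hrange : ∀ y, L p y ∈ C := by
    intro y
    set η : ℝ := κ / (2 * (1 + ‖y‖)) with hη
    have hηpos : 0 < η := by positivity
    have hηy : η * ‖y‖ < κ := by
      rw [hη, div_mul_eq_mul_div, div_lt_iff₀ (by positivity)]
      nlinarith [norm_nonneg y]
    have h1 : ∀ n, w (φ n) + η • y ∈ C := by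
      intro n
      by_contra hc
      have := hw (φ n) _ hc
      rw [sub_add_cancel_left, norm_neg, norm_smul, hw1, Real.norm_of_nonneg hηpos.le] at this
      linarith
    have h2 : Tendsto (fun n => L (e (φ n)) (w (φ n) + η • y)) atTop (nhds (η • L p y)) := by
      have h3 : Tendsto (fun n => L (e (φ n)) (η • y)) atTop (nhds (L p (η • y))) :=
        ((ContinuousLinearMap.apply ℝ X (η • y)).continuous.tendsto (L p)).comp hLlim
      have := hz.add h3
      simpa only [map_add, zero_add, map_smul] using this
    have h3 := hcl.mem_of_tendsto h2 (Eventually.of_forall fun n => hmapC _ _ (h1 n))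
    exact (cone_smul_mem_iff hsc hηpos.ne').1 h3
  obtain ⟨W, hWr, hWint⟩ := hsolid
  have hWC : (W : Set X) ⊆ C := fun v hv => by
    rcases eq_or_ne v 0 with rfl | h
    · exact h0
    · exact interior_subset (hWint ⟨hv, h⟩)
  have hker : ∀ v ∈ C, L p v = 0 → v = 0 := by
    intro v hv h
    by_contra hne
    exact hint (h ▸ hL p v hv hne)
  have : FiniteDimensional ℝ W := Module.rank_lt_aleph0_iff.1 (by
    rw [hWr]; exact Cardinal.natCast_lt_aleph0)
  have hWfr : Module.finrank ℝ W = k := Module.finrank_eq_of_rank_eq hWr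
  set g : W →ₗ[ℝ] X := (L p : X →ₗ[ℝ] X).comp W.subtype with hg
  have hgker : LinearMap.ker g = ⊥ := by
    rw [LinearMap.ker_eq_bot']
    intro v hv
    exact Subtype.ext (hker v (hWC v.2) hv)
  have hRr : Module.rank ℝ (LinearMap.range (L p : X →ₗ[ℝ] X)) ≤ k := by
    apply hmax
    rintro _ ⟨y, rfl⟩
    exact hrange y
  have : FiniteDimensional ℝ (LinearMap.range (L p : X →ₗ[ℝ] X)) :=
    Module.rank_lt_aleph0_iff.1 (lt_of_le_of_lt hRr Cardinal.natCast_lt_aleph0)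
  have hgr : LinearMap.range g = LinearMap.range (L p : X →ₗ[ℝ] X) := by
    apply Submodule.eq_of_le_of_finrank_le
    · rintro _ ⟨y, rfl⟩
      exact ⟨y, rfl⟩
    · rw [LinearMap.finrank_range_of_inj (LinearMap.ker_eq_bot.1 hgker), hWfr]
      exact Module.finrank_le_of_rank_le hRr
  obtain ⟨K, hK, hanti⟩ := g.exists_antilipschitzWith hgker
  have hWlow : ∀ n, ∃ v : W, L p v = L p (w n) := by
    intro n
    have : L p (w n) ∈ LinearMap.range g := by rw [hgr]; exact ⟨w n, rfl⟩
    obtain ⟨v, hv⟩ := this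
    exact ⟨v, hv⟩
  choose v hv using hWlow
  have hvlow : ∀ n, min κ 1 ≤ ‖v n‖ := by
    intro n
    by_cases hc : w n - v n ∈ C
    · have := hker _ hc (by rw [map_sub, hv, sub_self])
      rw [sub_eq_zero] at this
      rw [Submodule.coe_norm, ← this, hw1]
      exact min_le_right _ _
    · have := hw n _ hc
      rw [hw1, sub_sub_cancel, mul_one] at this
      exact (min_le_left _ _).trans this
  have hLv : ∀ n, min κ 1 ≤ K * ‖L p (w n)‖ := by
    intro n
    refine (hvlow n).trans ?_
    have := hanti.le_mul_norm (map_zero g) (v n)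
    rw [← hv]
    exact this
  have hz2 : Tendsto (fun n => L p (w (φ n))) atTop (nhds 0) := by
    have h1 : Tendsto (fun n => (L p - L (e (φ n))) (w (φ n))) atTop (nhds 0) := by
      have h2 : Tendsto (fun n => ‖L p - L (e (φ n))‖) atTop (nhds 0) := by
        have := (tendsto_const_nhds (x := L p)).sub hLlim
        simpa using this.norm
      refine squeeze_zero_norm (fun n => ?_) h2
      simpa [hw1] using (L p - L (e (φ n))).le_opNorm (w (φ n))
    simpa using h1.add hz
  have hfin : Tendsto (fun n => K * ‖L p (w (φ n))‖) atTop (nhds 0) := by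
    simpa using hz2.norm.const_mul (K : ℝ)
  have := ge_of_tendsto hfin (Eventually.of_forall fun n => hLv (φ n))
  have : 0 < min κ 1 := lt_min hκ one_pos
  linarith

/-- Under linearized focusing along a forward invariant compact set, ordered differences grow,
over a fixed time and in a uniform neighbourhood, at least twice as fast as differences that
remain unordered. -/
theorem exists_uniform_comparison {Φ : Semiflow X} {DΦ : ℝ → X → X →L[ℝ] X} {C : Set X}
    (h0 : (0 : X) ∈ C) (hsc : ∀ (t : ℝ) (v : X), v ∈ C → t • v ∈ C)
    (hD : ∀ t, 0 ≤ t → ∀ x : X, HasFDerivAt (Φ.toFun t) (DΦ t x) x)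
    (hDc : ∀ t, 0 ≤ t → Continuous fun x : X => DΦ t x)
    {S : Set X} (hS : IsCompact S) (hinv : ∀ t, 0 ≤ t → ∀ e ∈ S, Φ.toFun t e ∈ S)
    {T κ m : ℝ} (hT : 0 < T) (hκ : 0 < κ) (hm : 0 < m)
    (hfoc : ∀ e ∈ S, ∀ v ∈ C, DΦ T e v ∈ deepCone C κ)
    (hlow : ∀ e ∈ S, ∀ w ∈ deepCone C κ, m * ‖w‖ ≤ ‖DΦ T e w‖) :
    ∃ τ ≥ T, ∃ ε > (0 : ℝ), ∀ e ∈ S, ∀ a ∈ closedBall e ε, ∀ b ∈ closedBall e ε,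
      ∀ c ∈ closedBall e ε, ∀ d ∈ closedBall e ε, a - b ∈ deepCone C κ →
      Φ.toFun τ c - Φ.toFun τ d ∉ C →
      2 * ‖a - b‖ * ‖Φ.toFun τ c - Φ.toFun τ d‖ ≤ ‖Φ.toFun τ a - Φ.toFun τ b‖ * ‖c - d‖ := by
  obtain ⟨l, hl, r, hr, hgrow⟩ := exists_linear_ratio_growth hsc h0 hκ
  obtain ⟨M₀, hM₀⟩ := hS.exists_bound_of_continuousOn (hDc T hT.le).continuousOn
  set M : ℝ := |M₀| + 1 with hMdef
  have hM : 0 < M := by positivity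
  have hMb : ∀ e ∈ S, ‖DΦ T e‖ ≤ M := fun e he =>
    (hM₀ e he).trans ((le_abs_self _).trans (by linarith))
  obtain ⟨n, hn⟩ : ∃ n : ℕ, 8 * M / (r * m) < (1 + l) ^ n :=
    pow_unbounded_of_one_lt _ (by linarith)
  have hn8 : 8 * M ≤ r * (1 + l) ^ n * m := by
    rw [div_lt_iff₀ (by positivity)] at hn
    nlinarith
  set τ : ℝ := ((n + 2 : ℕ) : ℝ) * T with hτ
  have hτ0 : 0 ≤ τ := by positivity
  set μ : ℝ := m ^ (n + 2) with hμ
  have hμpos : 0 < μ := by positivity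
  set η : ℝ := μ * κ / (8 * (1 + κ)) with hη
  have hηpos : 0 < η := by positivity
  have hη1 : η * (8 * (1 + κ)) = μ * κ := by rw [hη]; field_simp
  have hη2 : 8 * η ≤ μ := by
    have : η * 8 * κ ≤ μ * κ := by nlinarith
    nlinarith
  obtain ⟨ε, hε, hstrict⟩ := hS.exists_uniform_strict_fderiv (hD τ hτ0) (hDc τ hτ0) hηpos
  refine ⟨τ, ?_, ε, hε, fun e he a ha b hb c hc d hd hab hcd => ?_⟩
  · rw [hτ]; push_cast; nlinarith [(Nat.cast_nonneg n : (0 : ℝ) ≤ n)]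
  set A : ℕ → X →L[ℝ] X := fun i => DΦ ((i : ℝ) * T) e with hA
  set L : ℕ → X →L[ℝ] X := fun i => DΦ T (Φ.toFun ((i : ℝ) * T) e) with hL
  have hmem : ∀ i : ℕ, Φ.toFun ((i : ℝ) * T) e ∈ S := fun i => hinv _ (by positivity) e he
  have hA0 : ∀ u, A 0 u = u := by
    have : A 0 = ContinuousLinearMap.id ℝ X := by
      refine (hD (((0 : ℕ) : ℝ) * T) (by simp) e).unique ?_
      have : Φ.toFun (((0 : ℕ) : ℝ) * T) = id := by ext y; simp [Φ.map_zero]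
      rw [this]
      exact hasFDerivAt_id e
    intro u; rw [this]; rfl
  have hAs : ∀ i u, A (i + 1) u = L i (A i u) := by
    intro i u
    have : A (i + 1) = (L i).comp (A i) := by
      refine (hD (((i + 1 : ℕ) : ℝ) * T) (by positivity) e).unique ?_
      have : Φ.toFun (((i + 1 : ℕ) : ℝ) * T) = Φ.toFun T ∘ Φ.toFun ((i : ℝ) * T) := by
        ext y
        rw [Function.comp_apply, ← Φ.map_add _ _ hT.le (by positivity)]
        congr 1
        push_cast; ring
      rw [this]
      exact (hD T hT.le _).comp e (hD _ (by positivity) e)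
    rw [this]; rfl
  have hsub := deepCone_subset hκ h0
  have hwd : ∀ i, A i (a - b) ∈ deepCone C κ := by
    intro i
    induction i with
    | zero => rwa [hA0]
    | succ i ih => rw [hAs]; exact hfoc _ (hmem i) _ (hsub ih)
  have hwlow : ∀ i, m ^ i * ‖a - b‖ ≤ ‖A i (a - b)‖ := by
    intro i
    induction i with
    | zero => simp [hA0]
    | succ i ih =>
      rw [hAs]
      refine le_trans ?_ (hlow _ (hmem i) _ (hwd i))
      rw [pow_succ]
      nlinarith
  have hμw : μ * ‖a - b‖ ≤ ‖A (n + 2) (a - b)‖ := hwlow (n + 2)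
  have hsab : ‖Φ.toFun τ a - Φ.toFun τ b - A (n + 2) (a - b)‖ ≤ η * ‖a - b‖ :=
    hstrict e he a ha b hb
  have hscd : ‖Φ.toFun τ c - Φ.toFun τ d - A (n + 2) (c - d)‖ ≤ η * ‖c - d‖ :=
    hstrict e he c hc d hd
  have hV' : ‖Φ.toFun τ c - Φ.toFun τ d‖ ≤ ‖A (n + 2) (c - d)‖ + η * ‖c - d‖ := by
    have := norm_le_norm_add_norm_sub' (Φ.toFun τ c - Φ.toFun τ d) (A (n + 2) (c - d))
    linarith
  have hW' : ‖A (n + 2) (a - b)‖ - η * ‖a - b‖ ≤ ‖Φ.toFun τ a - Φ.toFun τ b‖ := by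
    have := norm_le_norm_add_norm_sub (Φ.toFun τ a - Φ.toFun τ b) (A (n + 2) (a - b))
    linarith
  have hcore : ‖A (n + 2) (c - d)‖ * κ ≤ η * ‖c - d‖ ∨
      8 * ‖a - b‖ * ‖A (n + 2) (c - d)‖ ≤ ‖c - d‖ * ‖A (n + 2) (a - b)‖ := by
    by_cases hin : A (n + 1) (c - d) ∈ C
    · left
      have h1 : A (n + 2) (c - d) ∈ deepCone C κ := by
        rw [hAs]; exact hfoc _ (hmem _) _ hin
      have h2 := h1 _ hcd
      rw [norm_sub_rev] at h2
      linarith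
    · right
      have h1 := hgrow L (fun i v hv => hfoc _ (hmem i) v hv) (fun i => A i (a - b))
        (fun i => A i (c - d)) (fun i => hAs i _) (fun i => hAs i _) (hwd 0) n hin
      simp only [hA0] at h1
      have h2 : ‖A (n + 2) (c - d)‖ ≤ M * ‖A (n + 1) (c - d)‖ := by
        rw [hAs]
        exact ((L (n + 1)).le_opNorm _).trans
          (mul_le_mul_of_nonneg_right (hMb _ (hmem _)) (norm_nonneg _))
      have h3 : m * ‖A (n + 1) (a - b)‖ ≤ ‖A (n + 2) (a - b)‖ := by
        rw [hAs (n + 1)]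
        exact hlow _ (hmem _) _ (hwd _)
      calc 8 * ‖a - b‖ * ‖A (n + 2) (c - d)‖
          ≤ 8 * ‖a - b‖ * (M * ‖A (n + 1) (c - d)‖) := by gcongr
        _ = 8 * M * (‖a - b‖ * ‖A (n + 1) (c - d)‖) := by ring
        _ ≤ r * (1 + l) ^ n * m * (‖a - b‖ * ‖A (n + 1) (c - d)‖) := by gcongr
        _ = m * (r * (1 + l) ^ n * (‖a - b‖ * ‖A (n + 1) (c - d)‖)) := by ring
        _ ≤ m * (‖c - d‖ * ‖A (n + 1) (a - b)‖) := by gcongr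
        _ = ‖c - d‖ * (m * ‖A (n + 1) (a - b)‖) := by ring
        _ ≤ _ := by gcongr
  have hW0 : 0 ≤ ‖a - b‖ := norm_nonneg _
  have hV0 : 0 ≤ ‖c - d‖ := norm_nonneg _
  generalize ‖a - b‖ = W, ‖c - d‖ = V, ‖A (n + 2) (a - b)‖ = WN, ‖A (n + 2) (c - d)‖ = VN,
    ‖Φ.toFun τ a - Φ.toFun τ b‖ = W', ‖Φ.toFun τ c - Φ.toFun τ d‖ = V' at *
  have hηW : 8 * (η * W) ≤ WN := by nlinarith
  have hWW : WN ≤ 2 * W' := by nlinarith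
  have hηWV : 8 * (η * W) * V ≤ WN * V := by gcongr
  have hWWV : WN * V ≤ 2 * W' * V := by gcongr
  have hWV' : W * V' ≤ W * (VN + η * V) := by gcongr
  rcases hcore with h | h
  · have h1 : W * (VN * κ) ≤ W * (η * V) := by gcongr
    have h2 : 8 * (W * (VN + η * V)) * κ ≤ WN * V * κ := by
      have h3 : 8 * (W * (VN + η * V)) * κ ≤ 8 * (W * V) * (η * (1 + κ)) := by nlinarith
      have h4 : 8 * (W * V) * (η * (1 + κ)) = (μ * W) * (V * κ) := by
        have : 8 * (W * V) * (η * (1 + κ)) = (W * V) * (η * (8 * (1 + κ))) := by ring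
        rw [this, hη1]; ring
      have h5 : (μ * W) * (V * κ) ≤ WN * (V * κ) := by gcongr
      linarith
    have h3 := le_of_mul_le_mul_right h2 hκ
    have hpos : 0 ≤ 8 * (η * W) * V := by positivity
    linarith
  · nlinarith

end Linearization


section Omega

open Topology

theorem mem_iInter_closure_tail_iff {X : Type*} [PseudoMetricSpace X] {f : ℝ → X} {p : X} :
    p ∈ ⋂ s ∈ Ici (0 : ℝ), closure {y | ∃ t, s ≤ t ∧ y = f t} ↔
      ∃ t : ℕ → ℝ, Tendsto t atTop atTop ∧ Tendsto (fun n => f (t n)) atTop (𝓝 p) := by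
  simp only [mem_iInter, mem_Ici]
  constructor
  · intro h
    have h1 : ∀ n : ℕ, ∃ t, (n : ℝ) ≤ t ∧ dist (f t) p < 1 / ((n : ℝ) + 1) := by
      intro n
      obtain ⟨_, ⟨t, ht, rfl⟩, hd⟩ := Metric.mem_closure_iff.1 (h n (Nat.cast_nonneg n))
        (1 / ((n : ℝ) + 1)) (by positivity)
      exact ⟨t, ht, by rwa [dist_comm]⟩
    choose t ht hd using h1
    refine ⟨t, tendsto_atTop_mono ht tendsto_natCast_atTop_atTop, ?_⟩
    rw [tendsto_iff_dist_tendsto_zero]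
    exact squeeze_zero (fun _ => dist_nonneg) (fun n => (hd n).le)
      (tendsto_one_div_add_atTop_nhds_zero_nat (𝕜 := ℝ))
  · rintro ⟨t, ht, hlim⟩ s -
    refine mem_closure_of_tendsto hlim ?_
    filter_upwards [ht.eventually_ge_atTop s] with n hn
    exact ⟨t n, hn, rfl⟩

variable {X : Type*} [NormedAddCommGroup X] [NormedSpace ℝ X] {Φ : Semiflow X}

theorem Semiflow.tendsto_toFun (Φ : Semiflow X) {ι : Type*} {l : Filter ι} {t : ι → ℝ}
    {y : ι → X} {t₀ : ℝ} {y₀ : X} (ht₀ : 0 ≤ t₀) (htn : ∀ᶠ i in l, 0 ≤ t i)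
    (ht : Tendsto t l (𝓝 t₀)) (hy : Tendsto y l (𝓝 y₀)) :
    Tendsto (fun i => Φ.toFun (t i) (y i)) l (𝓝 (Φ.toFun t₀ y₀)) := by
  have h := Φ.cont (t₀, y₀) ⟨ht₀, trivial⟩
  refine h.tendsto.comp (tendsto_nhdsWithin_iff.2 ⟨ht.prodMk_nhds hy, ?_⟩)
  filter_upwards [htn] with i hi using ⟨hi, trivial⟩

theorem Semiflow.continuous_toFun (Φ : Semiflow X) {t : ℝ} (ht : 0 ≤ t) :
    Continuous (Φ.toFun t) :=
  continuous_iff_continuousAt.2 fun _ =>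
    Φ.tendsto_toFun ht (Eventually.of_forall fun _ => ht) tendsto_const_nhds tendsto_id

theorem mem_omegaSet_iff {x p : X} : p ∈ omegaSet Φ x ↔
    ∃ t : ℕ → ℝ, Tendsto t atTop atTop ∧ Tendsto (fun n => Φ.toFun (t n) x) atTop (𝓝 p) :=
  mem_iInter_closure_tail_iff

theorem mem_omegaSet_of_tendsto {ι : Type*} {l : Filter ι} [l.NeBot] {x p : X} {t : ι → ℝ}
    (ht : Tendsto t l atTop) (h : Tendsto (fun n => Φ.toFun (t n) x) l (𝓝 p)) :
    p ∈ omegaSet Φ x := by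
  simp only [omegaSet, mem_iInter]
  intro s _
  refine mem_closure_of_tendsto h ?_
  filter_upwards [ht.eventually_ge_atTop s] with n hn
  exact ⟨t n, hn, rfl⟩

theorem isClosed_omegaSet (Φ : Semiflow X) (x : X) : IsClosed (omegaSet Φ x) :=
  isClosed_biInter fun _ _ => isClosed_closure

theorem omegaSet_subset_closure (Φ : Semiflow X) (x : X) :
    omegaSet Φ x ⊆ closure (posOrbit Φ x) := by
  intro p hp
  simp only [omegaSet, mem_iInter] at hp
  exact hp 0 self_mem_Ici

theorem isCompact_omegaSet {x : X} (hpre : IsCompact (closure (posOrbit Φ x))) :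
    IsCompact (omegaSet Φ x) :=
  hpre.of_isClosed_subset (isClosed_omegaSet Φ x) (omegaSet_subset_closure Φ x)

theorem exists_omegaSet_subseq {x : X} (hpre : IsCompact (closure (posOrbit Φ x)))
    {t : ℕ → ℝ} (ht : Tendsto t atTop atTop) : ∃ p ∈ omegaSet Φ x, ∃ φ : ℕ → ℕ,
      StrictMono φ ∧ Tendsto (fun n => Φ.toFun (t (φ n)) x) atTop (𝓝 p) := by
  obtain ⟨p, -, φ, hφ, h⟩ := hpre.tendsto_subseq' (x := fun n => Φ.toFun (t n) x)
    ((ht.eventually_ge_atTop 0).mono fun n hn =>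
      subset_closure (show Φ.toFun (t n) x ∈ posOrbit Φ x from ⟨t n, hn, rfl⟩)).frequently
  exact ⟨p, mem_omegaSet_of_tendsto (ht.comp hφ.tendsto_atTop) h, φ, hφ, h⟩

theorem toFun_mem_omegaSet {x p : X} (hp : p ∈ omegaSet Φ x) {s : ℝ} (hs : 0 ≤ s) :
    Φ.toFun s p ∈ omegaSet Φ x := by
  obtain ⟨t, ht, h⟩ := mem_omegaSet_iff.1 hp
  refine mem_omegaSet_of_tendsto (tendsto_atTop_add_const_left atTop s ht) ?_
  refine (((Φ.continuous_toFun hs).tendsto p).comp h).congr' ?_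
  filter_upwards [ht.eventually_ge_atTop 0] with n hn
  exact (Φ.map_add s (t n) hs hn x).symm

theorem omegaSet_subset_of_mem {x p : X} (hp : p ∈ omegaSet Φ x) :
    omegaSet Φ p ⊆ omegaSet Φ x := by
  intro q hq
  obtain ⟨t, ht, h⟩ := mem_omegaSet_iff.1 hq
  refine (isClosed_omegaSet Φ x).mem_of_tendsto h ?_
  filter_upwards [ht.eventually_ge_atTop 0] with n hn
  exact toFun_mem_omegaSet hp hn

/-- An orbit with compact closure approaches its ω-limit set. -/
theorem eventually_exists_dist_omegaSet_lt {x : X} (hpre : IsCompact (closure (posOrbit Φ x)))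
    {ρ : ℝ} (hρ : 0 < ρ) :
    ∃ t₀ : ℝ, 0 ≤ t₀ ∧ ∀ t, t₀ ≤ t → ∃ e ∈ omegaSet Φ x, dist (Φ.toFun t x) e < ρ := by
  by_contra! hcon
  choose t ht hd using fun n : ℕ => hcon n (Nat.cast_nonneg n)
  have htt : Tendsto t atTop atTop := tendsto_atTop_mono ht tendsto_natCast_atTop_atTop
  obtain ⟨p, hp, φ, -, hlim⟩ := exists_omegaSet_subseq hpre htt
  obtain ⟨n, hn⟩ := ((tendsto_iff_dist_tendsto_zero.1 hlim).eventually_lt_const hρ).exists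
  exact absurd hn (not_lt.2 (hd (φ n) p hp))

end Omega

section Order

open Topology

variable {X : Type*} [NormedAddCommGroup X] [NormedSpace ℝ X]

/-- A precompact pseudo-ordered semiorbit of a strongly monotone semiflow, together with a flow
extension on its ω-limit set. -/
structure PseudoOrderedOrbit (Φ : Semiflow X) (C : Set X) (x : X) (ψ : ℝ → X → X) : Prop where
  zero_mem : (0 : X) ∈ C
  closed : IsClosed C
  smul_mem : ∀ (t : ℝ) (v : X), v ∈ C → t • v ∈ C
  mono : StronglyMonotone Φ C
  precompact : IsCompact (closure (posOrbit Φ x))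
  flow : IsFlowExtensionOn Φ ψ (omegaSet Φ x)
  pseudo : PseudoOrdered Φ C x

/-- The positive time shifts by which the semiorbit is strongly ordered with itself. -/
def orderedShifts (Φ : Semiflow X) (C : Set X) (x : X) : Set ℝ :=
  {s | 0 < s ∧ ∃ t, 0 ≤ t ∧ Φ.toFun (t + s) x - Φ.toFun t x ∈ interior C}

namespace PseudoOrderedOrbit

variable {Φ : Semiflow X} {C : Set X} {x : X} {ψ : ℝ → X → X}

theorem flow_zero (h : PseudoOrderedOrbit Φ C x ψ) {z : X} (hz : z ∈ omegaSet Φ x) :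
    ψ 0 z = z := by
  rw [h.flow.1 0 le_rfl z hz, Φ.map_zero]

theorem flow_mem (h : PseudoOrderedOrbit Φ C x ψ) (t : ℝ) {z : X} (hz : z ∈ omegaSet Φ x) :
    ψ t z ∈ omegaSet Φ x := h.flow.2.1 t z hz

theorem flow_add (h : PseudoOrderedOrbit Φ C x ψ) (s t : ℝ) {z : X} (hz : z ∈ omegaSet Φ x) :
    ψ s (ψ t z) = ψ (s + t) z := h.flow.2.2.1 s t z hz

theorem toFun_flow (h : PseudoOrderedOrbit Φ C x ψ) {s : ℝ} (hs : 0 ≤ s) (t : ℝ) {z : X}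
    (hz : z ∈ omegaSet Φ x) : Φ.toFun s (ψ t z) = ψ (s + t) z := by
  rw [← h.flow.1 s hs _ (h.flow_mem t hz), h.flow_add s t hz]

theorem flow_injOn (h : PseudoOrderedOrbit Φ C x ψ) (t : ℝ) {p q : X} (hp : p ∈ omegaSet Φ x)
    (hq : q ∈ omegaSet Φ x) (hpq : ψ t p = ψ t q) : p = q := by
  have h1 := h.flow_add (-t) t hp
  have h2 := h.flow_add (-t) t hq
  rw [neg_add_cancel, h.flow_zero hp] at h1
  rw [neg_add_cancel, h.flow_zero hq] at h2
  rw [← h1, ← h2, hpq]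

theorem toFun_injOn (h : PseudoOrderedOrbit Φ C x ψ) {t : ℝ} (ht : 0 ≤ t) {p q : X}
    (hp : p ∈ omegaSet Φ x) (hq : q ∈ omegaSet Φ x) (hpq : Φ.toFun t p = Φ.toFun t q) :
    p = q := by
  refine h.flow_injOn t hp hq ?_
  rw [h.flow.1 t ht p hp, h.flow.1 t ht q hq, hpq]

theorem tendsto_flow (h : PseudoOrderedOrbit Φ C x ψ) {ι : Type*} {l : Filter ι} {t : ι → ℝ}
    {y : ι → X} {t₀ : ℝ} {y₀ : X} (hy₀ : y₀ ∈ omegaSet Φ x) (hyn : ∀ i, y i ∈ omegaSet Φ x)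
    (ht : Tendsto t l (𝓝 t₀)) (hy : Tendsto y l (𝓝 y₀)) :
    Tendsto (fun i => ψ (t i) (y i)) l (𝓝 (ψ t₀ y₀)) := by
  have hc := h.flow.2.2.2 (t₀, y₀) ⟨trivial, hy₀⟩
  exact hc.tendsto.comp (tendsto_nhdsWithin_iff.2
    ⟨ht.prodMk_nhds hy, Eventually.of_forall fun i => ⟨trivial, hyn i⟩⟩)

theorem flow_sub_mem_interior (h : PseudoOrderedOrbit Φ C x ψ) {p q : X}
    (hp : p ∈ omegaSet Φ x) (hq : q ∈ omegaSet Φ x) (hpq : p ≠ q) {t t' : ℝ}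
    (hord : ψ t p - ψ t q ∈ C) (ht : t < t') : ψ t' p - ψ t' q ∈ interior C := by
  have h1 := h.mono.2 (t' - t) (sub_pos.2 ht) _ _ hord
    (fun h' => hpq (h.flow_injOn t hp hq h'))
  rwa [h.toFun_flow (sub_pos.2 ht).le t hp, h.toFun_flow (sub_pos.2 ht).le t hq,
    sub_add_cancel] at h1

theorem flow_sub_notMem (h : PseudoOrderedOrbit Φ C x ψ) {p q : X}
    (hp : p ∈ omegaSet Φ x) (hq : q ∈ omegaSet Φ x) (hpq : p ≠ q) {t t' : ℝ}
    (hord : ψ t' p - ψ t' q ∉ interior C) (ht : t < t') : ψ t p - ψ t q ∉ C :=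
  fun h' => hord (h.flow_sub_mem_interior hp hq hpq h' ht)

theorem toFun_sub_mem_of_mem_orderedShifts (h : PseudoOrderedOrbit Φ C x ψ) {s : ℝ}
    (hs : s ∈ orderedShifts Φ C x) {p : X} (hp : p ∈ omegaSet Φ x) : Φ.toFun s p - p ∈ C := by
  obtain ⟨hs0, t, ht, hts⟩ := hs
  obtain ⟨r, hr, hlim⟩ := mem_omegaSet_iff.1 hp
  refine h.closed.mem_of_tendsto
    ((((Φ.continuous_toFun hs0.le).tendsto p).comp hlim).sub hlim) ?_
  filter_upwards [hr.eventually_ge_atTop t] with n hn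
  have h1 := h.mono.1 (r n - t) (sub_nonneg.2 hn) _ _ (interior_subset hts)
  rw [← Φ.map_add _ _ (sub_nonneg.2 hn) (by linarith),
    ← Φ.map_add _ _ (sub_nonneg.2 hn) ht] at h1
  rw [Function.comp_apply, ← Φ.map_add _ _ hs0.le (ht.trans hn)]
  convert h1 using 3 <;> ring

theorem mem_orderedShifts_of_toFun_sub_mem (h : PseudoOrderedOrbit Φ C x ψ) {s : ℝ}
    (hs : 0 < s) {p : X} (hp : p ∈ omegaSet Φ x) (hord : Φ.toFun s p - p ∈ C)
    (hne : Φ.toFun s p ≠ p) : s ∈ orderedShifts Φ C x := by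
  have h1 := h.mono.2 1 one_pos _ _ hord hne
  rw [← Φ.map_add _ _ zero_le_one hs.le, add_comm, Φ.map_add _ _ hs.le zero_le_one] at h1
  obtain ⟨r, hr, hlim⟩ := mem_omegaSet_iff.1 (toFun_mem_omegaSet hp zero_le_one)
  have h2 := (((Φ.continuous_toFun hs.le).tendsto _).comp hlim).sub hlim
  obtain ⟨n, hn1, hn2⟩ := ((h2.eventually_mem (isOpen_interior.mem_nhds h1)).and
    (hr.eventually_ge_atTop 0)).exists
  refine ⟨hs, r n, hn2, ?_⟩
  rwa [Function.comp_apply, ← Φ.map_add _ _ hs.le hn2, add_comm] at hn1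

theorem isOpen_orderedShifts (Φ : Semiflow X) (C : Set X) (x : X) :
    IsOpen (orderedShifts Φ C x) := by
  rw [isOpen_iff_mem_nhds]
  rintro s ⟨hs, t, ht, hts⟩
  have h1 : Tendsto (fun s' => Φ.toFun (t + s') x - Φ.toFun t x) (𝓝 s)
      (𝓝 (Φ.toFun (t + s) x - Φ.toFun t x)) := by
    refine Tendsto.sub_const (Φ.tendsto_toFun (by linarith) ?_
      (tendsto_id.const_add t) tendsto_const_nhds) _
    filter_upwards [lt_mem_nhds hs] with s' hs'
    simp only [id]
    linarith
  filter_upwards [lt_mem_nhds hs, h1.eventually_mem (isOpen_interior.mem_nhds hts)] with s' h1 h2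
  exact ⟨h1, t, ht, h2⟩

theorem exists_mem_orderedShifts (h : PseudoOrderedOrbit Φ C x ψ) :
    ∃ s, s ∈ orderedShifts Φ C x := by
  have key : ∀ t₁ t₂ : ℝ, 0 ≤ t₁ → 0 ≤ t₂ → t₁ < t₂ → Φ.toFun t₁ x ≠ Φ.toFun t₂ x →
      Φ.toFun t₂ x - Φ.toFun t₁ x ∈ C → ∃ s, s ∈ orderedShifts Φ C x := by
    intro t₁ t₂ h1 h2 hlt hne hC
    refine ⟨t₂ - t₁, sub_pos.2 hlt, 1 + t₁, by linarith, ?_⟩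
    have := h.mono.2 1 one_pos _ _ hC hne.symm
    rw [← Φ.map_add _ _ zero_le_one h1, ← Φ.map_add _ _ zero_le_one h2] at this
    convert this using 3
    ring
  obtain ⟨t₁, t₂, h1, h2, hne, hC⟩ := h.pseudo
  rcases lt_trichotomy t₁ t₂ with hlt | rfl | hlt
  · exact key t₁ t₂ h1 h2 hlt hne (cone_sub_comm h.smul_mem hC)
  · exact absurd rfl hne
  · exact key t₂ t₁ h2 h1 hlt hne.symm hC

theorem toFun_eq_of_mem_closure_orderedShifts (h : PseudoOrderedOrbit Φ C x ψ) {s : ℝ}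
    (hs : 0 ≤ s) (hcl : s ∈ closure (orderedShifts Φ C x)) (hns : s ∉ orderedShifts Φ C x)
    {p : X} (hp : p ∈ omegaSet Φ x) : Φ.toFun s p = p := by
  rcases hs.eq_or_lt with rfl | hs
  · exact Φ.map_zero p
  by_contra hne
  refine hns (h.mem_orderedShifts_of_toFun_sub_mem hs hp ?_ hne)
  obtain ⟨r, hr, hlim⟩ := mem_closure_iff_seq_limit.1 hcl
  exact h.closed.mem_of_tendsto ((Φ.tendsto_toFun hs.le
    (Eventually.of_forall fun n => (hr n).1.le) hlim tendsto_const_nhds).sub_const p)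
    (Eventually.of_forall fun n => h.toFun_sub_mem_of_mem_orderedShifts (hr n) hp)

/-- Every point of the ω-limit set is ordered with all its forward translates. -/
theorem toFun_sub_mem (h : PseudoOrderedOrbit Φ C x ψ) {p : X} (hp : p ∈ omegaSet Φ x) {s : ℝ}
    (hs : 0 ≤ s) : Φ.toFun s p - p ∈ C := by
  obtain ⟨τ, hτ⟩ := h.exists_mem_orderedShifts
  have hτ0 : 0 < τ := hτ.1
  have hcompl : IsClosed (orderedShifts Φ C x)ᶜ := (isOpen_orderedShifts Φ C x).isClosed_compl
  obtain ⟨α, ⟨⟨hα0, hατ⟩, hαS⟩, hαmax⟩ :=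
    (isCompact_Icc.inter_right hcompl : IsCompact (Icc 0 τ ∩ _)).exists_isGreatest
      ⟨0, ⟨le_rfl, hτ0.le⟩, fun h' => lt_irrefl _ h'.1⟩
  have hατ' : α < τ := lt_of_le_of_ne hατ (fun h' => hαS (h' ▸ hτ))
  have hαI : ∀ s, α < s → s ≤ τ → s ∈ orderedShifts Φ C x := by
    intro s h1 h2
    by_contra h3
    exact absurd (hαmax ⟨⟨by linarith, h2⟩, h3⟩) (not_le.2 h1)
  have hαcl : α ∈ closure (orderedShifts Φ C x) := by
    refine closure_mono (fun s (hs : s ∈ Ioo α τ) => hαI s hs.1 hs.2.le) ?_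
    rw [closure_Ioo hατ'.ne]
    exact ⟨le_rfl, hατ⟩
  have hα : ∀ {p}, p ∈ omegaSet Φ x → Φ.toFun α p = p := fun hp =>
    h.toFun_eq_of_mem_closure_orderedShifts hα0 hαcl hαS hp
  have hshift : ∀ {r}, 0 ≤ r → r + α ∈ orderedShifts Φ C x → Φ.toFun r p - p ∈ C := by
    intro r hr hrS
    have := h.toFun_sub_mem_of_mem_orderedShifts hrS hp
    rwa [Φ.map_add r α hr hα0, hα hp] at this
  by_cases hex : ∃ s, τ ≤ s ∧ s ∉ orderedShifts Φ C x
  · obtain ⟨s₁, hs₁, hs₁S⟩ := hex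
    obtain ⟨β, ⟨⟨hβτ, hβs⟩, hβS⟩, hβmin⟩ :=
      (isCompact_Icc.inter_right hcompl : IsCompact (Icc τ s₁ ∩ _)).exists_isLeast
        ⟨s₁, ⟨hs₁, le_rfl⟩, hs₁S⟩
    have hβτ' : τ < β := lt_of_le_of_ne hβτ (fun h' => hβS (h' ▸ hτ))
    have hβI : ∀ s, α < s → s < β → s ∈ orderedShifts Φ C x := by
      intro s h1 h2
      rcases le_total s τ with h3 | h3
      · exact hαI s h1 h3
      · by_contra h4
        exact absurd (hβmin ⟨⟨h3, by linarith⟩, h4⟩) (not_le.2 h2)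
    have hβcl : β ∈ closure (orderedShifts Φ C x) := by
      refine closure_mono (fun s (hs : s ∈ Ioo α β) => hβI s hs.1 hs.2) ?_
      rw [closure_Ioo (hατ'.trans hβτ').ne]
      exact ⟨(hατ'.trans hβτ').le, le_rfl⟩
    set d : ℝ := β - α with hd
    have hd0 : 0 < d := by rw [hd]; linarith
    have hdp : Φ.toFun d p = p := by
      have h1 := h.toFun_eq_of_mem_closure_orderedShifts (by linarith) hβcl hβS hp
      have h2 : β = d + α := by rw [hd]; ring
      rwa [h2, Φ.map_add d α hd0.le hα0, hα hp] at h1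
    have hper : ∀ n : ℕ, Φ.toFun (n * d) p = p := by
      intro n
      induction n with
      | zero => simp [Φ.map_zero]
      | succ n ih =>
        have : ((n + 1 : ℕ) : ℝ) * d = n * d + d := by push_cast; ring
        rw [this, Φ.map_add _ _ (by positivity) hd0.le, hdp, ih]
    have hfl : (⌊s / d⌋₊ : ℝ) * d ≤ s := by
      have := Nat.floor_le (div_nonneg hs hd0.le)
      rwa [le_div_iff₀ hd0] at this
    have hfl2 : s < (⌊s / d⌋₊ + 1 : ℝ) * d := by
      have := Nat.lt_floor_add_one (s / d)
      rwa [div_lt_iff₀ hd0] at this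
    have hr0 : 0 ≤ s - ⌊s / d⌋₊ * d := by linarith
    have hsr : Φ.toFun s p = Φ.toFun (s - ⌊s / d⌋₊ * d) p := by
      conv_rhs => rw [← hper ⌊s / d⌋₊]
      rw [← Φ.map_add _ _ hr0 (by positivity), sub_add_cancel]
    rw [hsr]
    rcases hr0.eq_or_lt with h1 | h1
    · rw [← h1, Φ.map_zero, sub_self]; exact h.zero_mem
    · refine hshift hr0 (hβI _ (by linarith) ?_)
      have : β = d + α := by rw [hd]; ring
      linarith
  · push Not at hex
    rcases hs.eq_or_lt with rfl | hs
    · rw [Φ.map_zero, sub_self]; exact h.zero_mem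
    · refine hshift hs.le ?_
      rcases le_total (s + α) τ with h3 | h3
      · exact hαI _ (by linarith) h3
      · exact hex _ h3

/-- An equilibrium ordered with another point of the ω-limit set is ordered with all of it. -/
theorem sub_mem_of_equilibrium (h : PseudoOrderedOrbit Φ C x ψ) {e q : X}
    (he : e ∈ equilibria Φ) (hq : q ∈ omegaSet Φ x) (hqe : q ≠ e) (hord : q - e ∈ C) {a : X}
    (ha : a ∈ omegaSet Φ x) : a - e ∈ C := by
  have h1 := h.mono.2 1 one_pos _ _ hord hqe
  rw [he 1 zero_le_one] at h1
  obtain ⟨r, hr, hlim⟩ := mem_omegaSet_iff.1 (toFun_mem_omegaSet hq zero_le_one)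
  obtain ⟨n, hn1, hn2⟩ := (((hlim.sub_const e).eventually_mem
    (isOpen_interior.mem_nhds h1)).and (hr.eventually_ge_atTop 0)).exists
  obtain ⟨t, ht, hlim'⟩ := mem_omegaSet_iff.1 ha
  refine h.closed.mem_of_tendsto (hlim'.sub_const e) ?_
  filter_upwards [ht.eventually_ge_atTop (r n)] with i hi
  have h2 := h.mono.1 (t i - r n) (sub_nonneg.2 hi) _ _ (interior_subset hn1)
  rwa [← Φ.map_add _ _ (sub_nonneg.2 hi) hn2, sub_add_cancel, he _ (sub_nonneg.2 hi)] at h2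

end PseudoOrderedOrbit

end Order

section Limits

open Topology

variable {X : Type*} [NormedAddCommGroup X] [NormedSpace ℝ X]
  {Φ : Semiflow X} {C : Set X} {x : X} {ψ : ℝ → X → X}

theorem mem_equilibria_of_small_times {p : X} {η : ℝ} (hη : 0 < η)
    (hp : ∀ r, 0 ≤ r → r < η → Φ.toFun r p = p) : p ∈ equilibria Φ := by
  intro t ht
  obtain ⟨n, hn⟩ := exists_nat_gt (t / η)
  have hn0 : (0 : ℝ) < n := (div_nonneg ht hη.le).trans_lt hn
  have hr : t / n < η := by rwa [div_lt_comm₀ hn0 hη]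
  have hr0 : 0 ≤ t / n := div_nonneg ht hn0.le
  have hper : ∀ i : ℕ, Φ.toFun (i * (t / n)) p = p := by
    intro i
    induction i with
    | zero => simp [Φ.map_zero]
    | succ i ih =>
      have : ((i + 1 : ℕ) : ℝ) * (t / n) = i * (t / n) + t / n := by push_cast; ring
      rw [this, Φ.map_add _ _ (by positivity) hr0, hp _ hr0 hr, ih]
  have := hper n
  rwa [mul_div_cancel₀ _ hn0.ne'] at this

theorem mem_closure_nonperiods {p : X} (hp : p ∉ equilibria Φ) {s : ℝ} (hs : 0 ≤ s) :
    s ∈ closure {s' : ℝ | 0 ≤ s' ∧ Φ.toFun s' p ≠ p} := by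
  by_contra hcl
  obtain ⟨η, hη, hball⟩ := Metric.mem_nhds_iff.1 (isClosed_closure.isOpen_compl.mem_nhds hcl)
  have hall : ∀ r, 0 ≤ r → r < η → Φ.toFun (s + r) p = p := by
    intro r hr hrη
    by_contra hne
    have hmem : s + r ∈ ball s η := by
      rwa [mem_ball, Real.dist_eq, add_sub_cancel_left, abs_of_nonneg hr]
    exact hball hmem (subset_closure ⟨by linarith, hne⟩)
  refine hp (mem_equilibria_of_small_times hη fun r hr hrη => ?_)
  have h1 := hall r hr hrη
  have h2 := hall 0 le_rfl hη
  rw [add_zero] at h2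
  rwa [add_comm, Φ.map_add r s hr hs, h2] at h1

namespace PseudoOrderedOrbit

theorem precompact_of_mem (h : PseudoOrderedOrbit Φ C x ψ) {p : X} (hp : p ∈ omegaSet Φ x) :
    IsCompact (closure (posOrbit Φ p)) := by
  refine (isCompact_omegaSet h.precompact).of_isClosed_subset isClosed_closure
    (closure_minimal ?_ (isClosed_omegaSet Φ x))
  rintro _ ⟨t, ht, rfl⟩
  exact toFun_mem_omegaSet hp ht

theorem flow_mem_omegaSet_of_mem (h : PseudoOrderedOrbit Φ C x ψ) {p b : X}
    (hp : p ∈ omegaSet Φ x) (hb : b ∈ omegaSet Φ p) (t : ℝ) : ψ t b ∈ omegaSet Φ p := by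
  obtain ⟨r, hr, hlim⟩ := mem_omegaSet_iff.1 hb
  have hr' : Tendsto (fun n => max (r n) 0) atTop atTop :=
    tendsto_atTop_mono (fun n => le_max_left _ _) hr
  refine mem_omegaSet_of_tendsto (tendsto_atTop_add_const_left atTop t hr') ?_
  have h1 : Tendsto (fun n => Φ.toFun (max (r n) 0) p) atTop (𝓝 b) := by
    refine hlim.congr' ?_
    filter_upwards [hr.eventually_ge_atTop 0] with n hn
    rw [max_eq_left hn]
  have h2 := h.tendsto_flow (omegaSet_subset_of_mem hp hb)
    (fun n => toFun_mem_omegaSet hp (le_max_right _ _)) (tendsto_const_nhds (x := t)) h1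
  refine h2.congr' ?_
  filter_upwards [hr'.eventually_ge_atTop (-t)] with n hn
  rw [← h.flow.1 _ (le_max_right _ _) p hp, h.flow_add _ _ hp, h.flow.1 _ (by linarith) p hp]

/-- Each point of the ω-limit set is ordered with a whole semiorbit in the ω-limit set of any
given point that is not an equilibrium. -/
theorem exists_omegaSet_orbit_sub_mem (h : PseudoOrderedOrbit Φ C x ψ) {p a : X}
    (hp : p ∈ omegaSet Φ x) (hpE : p ∉ equilibria Φ) (ha : a ∈ omegaSet Φ x) :
    ∃ b ∈ omegaSet Φ p, ∀ s, 0 ≤ s → a - Φ.toFun s b ∈ C := by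
  obtain ⟨t, ht, htlim⟩ := mem_omegaSet_iff.1 hp
  obtain ⟨r₀, hr₀, hr₀lim⟩ := mem_omegaSet_iff.1 ha
  obtain ⟨b₀, hb₀, φ, hφ, hb₀lim⟩ := exists_omegaSet_subseq (h.precompact_of_mem hp) hr₀
  obtain ⟨r, hr, hralim, hrblim⟩ : ∃ r : ℕ → ℝ, Tendsto r atTop atTop ∧
      Tendsto (fun i => Φ.toFun (r i) x) atTop (𝓝 a) ∧
      Tendsto (fun i => Φ.toFun (r i) p) atTop (𝓝 b₀) :=
    ⟨fun i => r₀ (φ i), hr₀.comp hφ.tendsto_atTop, hr₀lim.comp hφ.tendsto_atTop, hb₀lim⟩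
  have hb₀S := omegaSet_subset_of_mem hp hb₀
  have hr' : Tendsto (fun n => max (r n) 0) atTop atTop :=
    tendsto_atTop_mono (fun n => le_max_left _ _) hr
  have hrblim' : Tendsto (fun n => Φ.toFun (max (r n) 0) p) atTop (𝓝 b₀) := by
    refine hrblim.congr' ?_
    filter_upwards [hr.eventually_ge_atTop 0] with n hn
    rw [max_eq_left hn]
  have hralim' : Tendsto (fun n => Φ.toFun (max (r n) 0) x) atTop (𝓝 a) := by
    refine hralim.congr' ?_
    filter_upwards [hr.eventually_ge_atTop 0] with n hn
    rw [max_eq_left hn]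
  have key : ∀ s, 0 ≤ s → Φ.toFun s p ≠ p → ∀ᶠ n in atTop, a - ψ (s - t n) b₀ ∈ C := by
    intro s hs hne
    have h1 : Φ.toFun s p - p ∈ interior C := by
      have h2 := h.toFun_sub_mem (h.flow_mem (-1) hp) hs
      rw [← h.flow.1 s hs _ (h.flow_mem (-1) hp), h.flow_add _ _ hp, add_comm,
        ← h.flow_add _ _ hp] at h2
      have h3 := h.flow_sub_mem_interior (h.flow_mem s hp) hp
        (by rwa [h.flow.1 s hs p hp]) h2 (show (-1 : ℝ) < 0 by norm_num)
      rwa [h.flow_zero (h.flow_mem s hp), h.flow_zero hp, h.flow.1 s hs p hp] at h3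
    filter_upwards [(htlim.const_sub (Φ.toFun s p)).eventually_mem
      (isOpen_interior.mem_nhds h1), ht.eventually_ge_atTop 0] with n hn hn0
    have hlim : Tendsto (fun i => Φ.toFun (max (r i) 0) x -
        ψ (s - t n) (Φ.toFun (max (r i) 0) p)) atTop (𝓝 (a - ψ (s - t n) b₀)) :=
      hralim'.sub (h.tendsto_flow hb₀S (fun i => toFun_mem_omegaSet hp (le_max_right _ _))
        tendsto_const_nhds hrblim')
    refine h.closed.mem_of_tendsto hlim ?_
    filter_upwards [hr'.eventually_ge_atTop (t n)] with i hi
    have h2 := h.mono.1 (max (r i) 0 - t n) (sub_nonneg.2 hi) _ _ (interior_subset hn)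
    rw [← Φ.map_add _ _ (sub_nonneg.2 hi) hn0, ← Φ.map_add _ _ (sub_nonneg.2 hi) hs,
      sub_add_cancel] at h2
    have h3 := cone_sub_comm h.smul_mem h2
    have h4 : ψ (s - t n) (Φ.toFun (max (r i) 0) p) =
        Φ.toFun (max (r i) 0 - t n + s) p := by
      rw [← h.flow.1 _ (le_max_right _ _) p hp, h.flow_add _ _ hp,
        ← h.flow.1 _ (by linarith) p hp]
      congr 1; ring
    rwa [h4]
  obtain ⟨b, hb, θ, hθ, hblim⟩ := (isCompact_omegaSet (h.precompact_of_mem hp)).tendsto_subseq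
    (fun n => h.flow_mem_omegaSet_of_mem hp hb₀ (-t n))
  have hbS := omegaSet_subset_of_mem hp hb
  refine ⟨b, hb, ?_⟩
  have key2 : ∀ s, 0 ≤ s → Φ.toFun s p ≠ p → a - Φ.toFun s b ∈ C := by
    intro s hs hne
    rw [← h.flow.1 s hs b hbS]
    refine h.closed.mem_of_tendsto ((h.tendsto_flow hbS
      (fun n => h.flow_mem (-t (θ n)) hb₀S) (tendsto_const_nhds (x := s)) hblim).const_sub a) ?_
    filter_upwards [hθ.tendsto_atTop.eventually (key s hs hne)] with n hn
    rwa [h.flow_add _ _ hb₀S]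
  intro s hs
  obtain ⟨s', hs', hlim⟩ := mem_closure_iff_seq_limit.1 (mem_closure_nonperiods hpE hs)
  exact h.closed.mem_of_tendsto ((Φ.tendsto_toFun hs (Eventually.of_forall fun n => (hs' n).1)
    hlim (tendsto_const_nhds (x := b))).const_sub a)
    (Eventually.of_forall fun n => key2 _ (hs' n).1 (hs' n).2)

/-- If the ω-limit set contains a point that is not an equilibrium, then each of its equilibria
is ordered with all of its points. -/
theorem sub_equilibrium_mem (h : PseudoOrderedOrbit Φ C x ψ) {p e : X}
    (hp : p ∈ omegaSet Φ x) (hpE : p ∉ equilibria Φ) (he : e ∈ omegaSet Φ x)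
    (heE : e ∈ equilibria Φ) {a : X} (ha : a ∈ omegaSet Φ x) : a - e ∈ C := by
  obtain ⟨b, hb, hbord⟩ := h.exists_omegaSet_orbit_sub_mem hp hpE he
  by_cases hbe : b = e
  · subst hbe
    have hpb : p - b ∈ C := by
      obtain ⟨r, hr, hlim⟩ := mem_omegaSet_iff.1 hb
      refine h.closed.mem_of_tendsto (hlim.const_sub p) ?_
      filter_upwards [hr.eventually_ge_atTop 0] with n hn
      exact cone_sub_comm h.smul_mem (h.toFun_sub_mem hp hn)
    exact h.sub_mem_of_equilibrium heE hp (fun h' => hpE (h' ▸ heE)) hpb ha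
  · have h1 := hbord 0 le_rfl
    rw [Φ.map_zero] at h1
    exact h.sub_mem_of_equilibrium heE (omegaSet_subset_of_mem hp hb) hbe
      (cone_sub_comm h.smul_mem h1) ha

end PseudoOrderedOrbit

end Limits

section Backward

open Topology

variable {X : Type*} [NormedAddCommGroup X] [NormedSpace ℝ X]
  {Φ : Semiflow X} {C : Set X} {x : X} {ψ : ℝ → X → X}

namespace PseudoOrderedOrbit

/-- If the ω-limit set contains a point that is not an equilibrium, then every α-limit set in it
contains a point that is ordered with all of the ω-limit set. -/
theorem exists_alphaSet_sub_mem (h : PseudoOrderedOrbit Φ C x ψ) {p a : X}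
    (hp : p ∈ omegaSet Φ x) (hpE : p ∉ equilibria Φ) (ha : a ∈ omegaSet Φ x) :
    ∃ m ∈ alphaSet ψ a, ∀ c ∈ omegaSet Φ x, c - m ∈ C := by
  have hcpt := isCompact_omegaSet h.precompact
  have hAcl : IsClosed (alphaSet ψ a) := isClosed_biInter fun _ _ => isClosed_closure
  have hAS : alphaSet ψ a ⊆ omegaSet Φ x := by
    intro m hm
    obtain ⟨t, -, hlim⟩ := mem_iInter_closure_tail_iff.1 hm
    exact (isClosed_omegaSet Φ x).mem_of_tendsto hlim
      (Eventually.of_forall fun n => h.flow_mem _ ha)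
  have hAne : (alphaSet ψ a).Nonempty := by
    obtain ⟨m, -, φ, hφ, hlim⟩ := hcpt.tendsto_subseq (fun n : ℕ => h.flow_mem (-(n : ℝ)) ha)
    exact ⟨m, mem_iInter_closure_tail_iff.2
      ⟨_, tendsto_natCast_atTop_atTop.comp hφ.tendsto_atTop, hlim⟩⟩
  have hAinv : ∀ s, 0 ≤ s → ∀ m ∈ alphaSet ψ a, Φ.toFun s m ∈ alphaSet ψ a := by
    intro s hs m hm
    obtain ⟨t, ht, hlim⟩ := mem_iInter_closure_tail_iff.1 hm
    refine mem_iInter_closure_tail_iff.2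
      ⟨fun n => -s + t n, tendsto_atTop_add_const_left atTop (-s) ht, ?_⟩
    refine (((Φ.continuous_toFun hs).tendsto m).comp hlim).congr fun n => ?_
    rw [Function.comp_apply, h.toFun_flow hs _ ha]
    congr 1; ring
  set F : Set (Set X) := {M | M.Nonempty ∧ IsClosed M ∧ M ⊆ alphaSet ψ a ∧
    ∀ s, 0 ≤ s → ∀ m ∈ M, Φ.toFun s m ∈ M} with hF
  obtain ⟨M, hM⟩ : ∃ M, Minimal (· ∈ F) M := by
    refine zorn_superset F fun c hc hchain => ?_
    rcases c.eq_empty_or_nonempty with rfl | hne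
    · exact ⟨alphaSet ψ a, ⟨hAne, hAcl, subset_rfl, hAinv⟩, by simp⟩
    obtain ⟨M₀, hM₀⟩ := hne
    have : Nonempty c := ⟨⟨M₀, hM₀⟩⟩
    refine ⟨⋂₀ c, ⟨?_, isClosed_sInter fun M hM => (hc hM).2.1,
      (sInter_subset_of_mem hM₀).trans (hc hM₀).2.2.1, fun s hs m hm M hM =>
        (hc hM).2.2.2 s hs m (hm M hM)⟩, fun M hM => sInter_subset_of_mem hM⟩
    exact IsCompact.nonempty_sInter_of_directed_nonempty_isCompact_isClosed
      (fun M₁ h₁ M₂ h₂ => (hchain.total h₁ h₂).elim (fun hs => ⟨M₁, h₁, subset_rfl, hs⟩)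
        fun hs => ⟨M₂, h₂, hs, subset_rfl⟩) (fun M hM => (hc hM).1)
      (fun M hM => hcpt.of_isClosed_subset (hc hM).2.1 ((hc hM).2.2.1.trans hAS))
      (fun M hM => (hc hM).2.1)
  obtain ⟨⟨m, hm⟩, hMcl, hMA, hMinv⟩ := hM.prop
  refine ⟨m, hMA hm, fun c hc => ?_⟩
  by_cases hmE : m ∈ equilibria Φ
  · exact h.sub_equilibrium_mem hp hpE (hAS (hMA hm)) hmE hc
  obtain ⟨b, hb, hord⟩ := h.exists_omegaSet_orbit_sub_mem (hAS (hMA hm)) hmE hc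
  have hbM : b ∈ M := by
    obtain ⟨t, ht, hlim⟩ := mem_omegaSet_iff.1 hb
    refine hMcl.mem_of_tendsto hlim ?_
    filter_upwards [ht.eventually_ge_atTop 0] with n hn
    exact hMinv _ hn m hm
  have hsub : closure (posOrbit Φ b) ⊆ M := by
    refine closure_minimal ?_ hMcl
    rintro _ ⟨t, ht, rfl⟩
    exact hMinv t ht b hbM
  have hmem : m ∈ closure (posOrbit Φ b) := by
    refine hM.le_of_le (y := closure (posOrbit Φ b)) ⟨⟨b, subset_closure
      ⟨0, le_rfl, (Φ.map_zero b).symm⟩⟩, isClosed_closure, hsub.trans hMA, ?_⟩ hsub hm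
    intro s hs z hz
    refine map_mem_closure (Φ.continuous_toFun hs) hz ?_
    rintro _ ⟨t, ht, rfl⟩
    exact ⟨s + t, by linarith, (Φ.map_add s t hs ht b).symm⟩
  have hclosed : IsClosed {z | c - z ∈ C} := h.closed.preimage (by fun_prop)
  refine closure_minimal ?_ hclosed hmem
  rintro _ ⟨t, ht, rfl⟩
  exact hord t ht

theorem flow_neg_sub_notMem (h : PseudoOrderedOrbit Φ C x ψ) {a b : X}
    (ha : a ∈ omegaSet Φ x) (hb : b ∈ omegaSet Φ x) (hab : a - b ∉ C) {t : ℝ} (ht : 0 ≤ t) :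
    ψ (-t) a - ψ (-t) b ∉ C := by
  intro h'
  have h1 := h.mono.1 t ht _ _ h'
  rw [h.toFun_flow ht _ ha, h.toFun_flow ht _ hb, add_neg_cancel, h.flow_zero ha,
    h.flow_zero hb] at h1
  exact hab h1

/-- Unordered pairs are proximal in backward time. -/
theorem exists_backward_proximal (h : PseudoOrderedOrbit Φ C x ψ) {p a b : X}
    (hp : p ∈ omegaSet Φ x) (hpE : p ∉ equilibria Φ) (ha : a ∈ omegaSet Φ x)
    (hb : b ∈ omegaSet Φ x) (hab : a - b ∉ C) :
    ∃ t : ℕ → ℝ, Tendsto t atTop atTop ∧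
      Tendsto (fun n => ψ (-t n) a - ψ (-t n) b) atTop (𝓝 0) := by
  obtain ⟨m, hm, hmord⟩ := h.exists_alphaSet_sub_mem hp hpE ha
  obtain ⟨t, ht, hlim⟩ := mem_iInter_closure_tail_iff.1 hm
  have hmS : m ∈ omegaSet Φ x := (isClosed_omegaSet Φ x).mem_of_tendsto hlim
    (Eventually.of_forall fun n => h.flow_mem _ ha)
  obtain ⟨m', hm'S, φ, hφ, hlim'⟩ := (isCompact_omegaSet h.precompact).tendsto_subseq
    (fun n => h.flow_mem (-t n) hb)
  have hlim2 : Tendsto (fun n => ψ (-t (φ n)) a) atTop (𝓝 m) := hlim.comp hφ.tendsto_atTop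
  have ht2 : Tendsto (fun n => t (φ n)) atTop atTop := ht.comp hφ.tendsto_atTop
  refine ⟨fun n => t (φ n), ht2, ?_⟩
  suffices m = m' by
    subst this
    simpa using hlim2.sub hlim'
  by_contra hne
  have h0 : ψ 0 m - ψ 0 m' ∈ C := by
    rw [h.flow_zero hmS, h.flow_zero hm'S]
    exact cone_sub_comm h.smul_mem (hmord m' hm'S)
  have h1 := h.flow_sub_mem_interior hmS hm'S hne h0 one_pos
  have h2 := (h.tendsto_flow hmS (fun n => h.flow_mem (-t (φ n)) ha)
    (tendsto_const_nhds (x := (1 : ℝ))) hlim2).sub (h.tendsto_flow hm'S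
    (fun n => h.flow_mem (-t (φ n)) hb) (tendsto_const_nhds (x := (1 : ℝ))) hlim')
  obtain ⟨n, hn1, hn2⟩ := ((h2.eventually_mem (isOpen_interior.mem_nhds h1)).and
    (ht2.eventually_ge_atTop 1)).exists
  simp only [h.flow_add _ _ ha, h.flow_add _ _ hb] at hn1
  have h3 := h.flow_neg_sub_notMem ha hb hab (sub_nonneg.2 hn2)
  rw [show -(t (φ n) - 1) = 1 + -t (φ n) by ring] at h3
  exact h3 (interior_subset hn1)

theorem exists_flow_dist_lt (h : PseudoOrderedOrbit Φ C x ψ) {R ε : ℝ} (hε : 0 < ε) :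
    ∃ η > (0 : ℝ), ∀ a ∈ omegaSet Φ x, ∀ b ∈ omegaSet Φ x, ‖a - b‖ < η →
      ∀ r, 0 ≤ r → r ≤ R → ‖ψ r a - ψ r b‖ < ε := by
  have hK : IsCompact (Icc 0 R ×ˢ omegaSet Φ x) :=
    isCompact_Icc.prod (isCompact_omegaSet h.precompact)
  have hu := hK.uniformContinuousOn_of_continuous
    (h.flow.2.2.2.mono (prod_mono (subset_univ _) subset_rfl))
  obtain ⟨η, hη, hu⟩ := Metric.uniformContinuousOn_iff.1 hu ε hε
  refine ⟨η, hη, fun a ha b hb hab r hr hrR => ?_⟩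
  have := hu (r, a) ⟨⟨hr, hrR⟩, ha⟩ (r, b) ⟨⟨hr, hrR⟩, hb⟩ (by
    rw [Prod.dist_eq, dist_self, dist_eq_norm]
    exact max_lt hη hab)
  rwa [dist_eq_norm] at this

/-- An unordered pair gives rise to a pair of distinct points whose backward orbits stay
unordered and close to each other. -/
theorem exists_close_backward_pair (h : PseudoOrderedOrbit Φ C x ψ) {p₀ a b : X}
    (hp₀ : p₀ ∈ omegaSet Φ x) (hpE : p₀ ∉ equilibria Φ) (ha : a ∈ omegaSet Φ x)
    (hb : b ∈ omegaSet Φ x) (hab : a - b ∉ C) {ε : ℝ} (hε : 0 < ε) :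
    ∃ p ∈ omegaSet Φ x, ∃ q ∈ omegaSet Φ x, ∀ t, 0 ≤ t →
      ψ (-t) p - ψ (-t) q ∉ C ∧ ‖ψ (-t) p - ψ (-t) q‖ ≤ ε := by
  obtain ⟨t, ht, hlim⟩ := h.exists_backward_proximal hp₀ hpE ha hb hab
  have hab0 : 0 < ‖a - b‖ := by
    rw [norm_pos_iff]; intro h'; exact hab (h' ▸ h.zero_mem)
  set δ : ℝ := min ε ‖a - b‖ with hδ
  have hδ0 : 0 < δ := lt_min hε hab0
  set g : ℝ → ℝ := fun t => ‖ψ (-t) a - ψ (-t) b‖ with hg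
  have hcont : ∀ {z}, z ∈ omegaSet Φ x → Continuous fun t : ℝ => ψ (-t) z := fun hz =>
    continuous_iff_continuousAt.2 fun t => h.tendsto_flow hz (fun _ => hz)
      (continuous_neg.tendsto t) tendsto_const_nhds
  have hgc : Continuous g := ((hcont ha).sub (hcont hb)).norm
  have hlast : ∀ n, 0 ≤ t n → ∃ s, 0 ≤ s ∧ s ≤ t n ∧ δ ≤ g s ∧
      ∀ r, s < r → r ≤ t n → g r < δ := by
    intro n hn
    obtain ⟨s, ⟨⟨hs0, hsn⟩, hs⟩, hmax⟩ :=
      (isCompact_Icc.inter_right (isClosed_le continuous_const hgc) :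
        IsCompact (Icc 0 (t n) ∩ {s | δ ≤ g s})).exists_isGreatest
        ⟨0, ⟨le_rfl, hn⟩, by
          change δ ≤ g 0
          simp only [hg, neg_zero, h.flow_zero ha, h.flow_zero hb]
          exact min_le_right _ _⟩
    refine ⟨s, hs0, hsn, hs, fun r hr hrn => ?_⟩
    by_contra! hge
    exact absurd (hmax ⟨⟨by linarith, hrn⟩, hge⟩) (not_le.2 hr)
  have hlast' : ∀ n, ∃ s, 0 ≤ t n → 0 ≤ s ∧ s ≤ t n ∧ δ ≤ g s ∧
      ∀ r, s < r → r ≤ t n → g r < δ := by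
    intro n
    by_cases hn : 0 ≤ t n
    · obtain ⟨s, hs⟩ := hlast n hn
      exact ⟨s, fun _ => hs⟩
    · exact ⟨0, fun h' => absurd h' hn⟩
  choose s hs using hlast'
  have hgap : Tendsto (fun n => t n - s n) atTop atTop := by
    rw [Filter.tendsto_atTop]
    intro R
    obtain ⟨η, hη, hclose⟩ := h.exists_flow_dist_lt (R := R) hδ0
    filter_upwards [ht.eventually_ge_atTop 0, (tendsto_norm_zero.comp hlim).eventually_lt_const hη]
      with n hn hn2
    by_contra! hlt
    obtain ⟨-, hsn, hsg, -⟩ := hs n hn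
    have h1 := hclose _ (h.flow_mem (-t n) ha) _ (h.flow_mem (-t n) hb) hn2 (t n - s n)
      (by linarith) hlt.le
    rw [h.flow_add _ _ ha, h.flow_add _ _ hb,
      show t n - s n + -t n = -s n by ring] at h1
    exact absurd hsg (not_le.2 h1)
  obtain ⟨p, hp, φ, hφ, hplim⟩ := (isCompact_omegaSet h.precompact).tendsto_subseq
    (fun n => h.flow_mem (-s n) ha)
  obtain ⟨q, hq, φ', hφ', hqlim⟩ := (isCompact_omegaSet h.precompact).tendsto_subseq
    (fun n => h.flow_mem (-s (φ n)) hb)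
  set θ : ℕ → ℕ := fun n => φ (φ' n) with hθ
  have hθt : Tendsto θ atTop atTop := hφ.tendsto_atTop.comp hφ'.tendsto_atTop
  have hplim2 : Tendsto (fun n => ψ (-s (θ n)) a) atTop (𝓝 p) := hplim.comp hφ'.tendsto_atTop
  have hqlim2 : Tendsto (fun n => ψ (-s (θ n)) b) atTop (𝓝 q) := hqlim
  have hdiff : ∀ r : ℝ, Tendsto (fun n => ψ (-(s (θ n) + r)) a - ψ (-(s (θ n) + r)) b) atTop
      (𝓝 (ψ (-r) p - ψ (-r) q)) := by
    intro r
    refine ((h.tendsto_flow hp (fun n => h.flow_mem (-s (θ n)) ha)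
      (tendsto_const_nhds (x := -r)) hplim2).sub (h.tendsto_flow hq
      (fun n => h.flow_mem (-s (θ n)) hb) (tendsto_const_nhds (x := -r)) hqlim2)).congr ?_
    intro n
    rw [h.flow_add _ _ ha, h.flow_add _ _ hb, show -r + -s (θ n) = -(s (θ n) + r) by ring]
  have hev := hθt.eventually (ht.eventually_ge_atTop 0)
  have hpq : p ≠ q := by
    rintro rfl
    have h1 := (hdiff 0).norm
    rw [sub_self, norm_zero] at h1
    obtain ⟨n, hn1, hn2⟩ := ((h1.eventually_lt_const hδ0).and hev).exists
    rw [add_zero] at hn1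
    exact absurd (hs _ hn2).2.2.1 (not_le.2 hn1)
  have hle : ∀ r, 0 < r → ‖ψ (-r) p - ψ (-r) q‖ ≤ ε := by
    intro r hr
    refine le_of_tendsto (hdiff r).norm ?_
    filter_upwards [hev, (hgap.comp hθt).eventually_ge_atTop r] with n hn1 hn2
    simp only [Function.comp_apply] at hn2
    exact ((hs _ hn1).2.2.2 (s (θ n) + r) (by linarith) (by linarith)).le.trans (min_le_left _ _)
  have hni : ∀ r, 0 ≤ r → ψ (-r) p - ψ (-r) q ∉ interior C := by
    intro r hr h'
    obtain ⟨n, hn1, hn2⟩ :=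
      (((hdiff r).eventually_mem (isOpen_interior.mem_nhds h')).and hev).exists
    exact h.flow_neg_sub_notMem ha hb hab (add_nonneg (hs _ hn2).1 hr) (interior_subset hn1)
  refine ⟨ψ (-1) p, h.flow_mem _ hp, ψ (-1) q, h.flow_mem _ hq, fun r hr => ?_⟩
  rw [h.flow_add _ _ hp, h.flow_add _ _ hq, ← neg_add]
  refine ⟨h.flow_sub_notMem hp hq hpq (hni 0 le_rfl) (by linarith), hle _ (by linarith)⟩

/-- Near an equilibrium of a nontrivial ω-limit set there is a whole semiorbit of the ω-limit
set that is different from the equilibrium. -/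
theorem exists_forward_orbit_near (h : PseudoOrderedOrbit Φ C x ψ) {e q : X}
    (he : e ∈ omegaSet Φ x) (heE : e ∈ equilibria Φ) (hq : q ∈ omegaSet Φ x) (hqe : q ≠ e)
    {ρ : ℝ} (hρ : 0 < ρ) : ∃ z ∈ omegaSet Φ x, z ≠ e ∧
      ∀ t, 0 ≤ t → Φ.toFun t z ∈ closedBall e ρ := by
  obtain ⟨δ, hδ0, hδρ, hδq⟩ : ∃ δ > (0 : ℝ), δ ≤ ρ ∧ δ < dist q e :=
    ⟨min ρ (dist q e / 2), lt_min hρ (half_pos (dist_pos.2 hqe)), min_le_left _ _,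
      (min_le_right _ _).trans_lt (half_lt_self (dist_pos.2 hqe))⟩
  obtain ⟨t, ht, htlim⟩ := mem_omegaSet_iff.1 hq
  obtain ⟨r, hr, hrlim⟩ := mem_omegaSet_iff.1 he
  have hcont : ContinuousOn (fun t : ℝ => dist (Φ.toFun t x) e) (Ici 0) := by
    intro t ht
    exact (Φ.tendsto_toFun ht self_mem_nhdsWithin (tendsto_id.mono_left nhdsWithin_le_nhds)
      tendsto_const_nhds).dist tendsto_const_nhds
  have hlast : ∀ n : ℕ, ∃ σ ρ' : ℝ, (n : ℝ) ≤ σ ∧ σ ≤ ρ' ∧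
      dist (Φ.toFun ρ' x) e < 1 / ((n : ℝ) + 1) ∧ δ ≤ dist (Φ.toFun σ x) e ∧
      ∀ u, σ < u → u ≤ ρ' → dist (Φ.toFun u x) e < δ := by
    intro n
    obtain ⟨i, hi1, hi2⟩ := (((htlim.dist (tendsto_const_nhds (x := e))).eventually_const_lt
      hδq).and (ht.eventually_ge_atTop (n : ℝ))).exists
    obtain ⟨j, hj1, hj2⟩ := (((tendsto_iff_dist_tendsto_zero.1 hrlim).eventually_lt_const
      (show (0 : ℝ) < 1 / ((n : ℝ) + 1) by positivity)).and
      (hr.eventually_ge_atTop (t i))).exists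
    have hti : 0 ≤ t i := (Nat.cast_nonneg n).trans hi2
    obtain ⟨σ, ⟨⟨hσ1, hσ2⟩, hσ⟩, hmax⟩ := ((hcont.mono fun u (hu : u ∈ Icc (t i) (r j)) =>
      hti.trans hu.1).preimage_isClosed_of_isClosed isClosed_Icc (isClosed_Ici (a := δ)) |>
      isCompact_Icc.of_isClosed_subset <| inter_subset_left).exists_isGreatest
      ⟨t i, ⟨le_rfl, hj2⟩, hi1.le⟩
    refine ⟨σ, r j, hi2.trans hσ1, hσ2, hj1, hσ, fun u hu huj => ?_⟩
    by_contra! hge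
    exact absurd (hmax ⟨⟨by linarith, huj⟩, hge⟩) (not_le.2 hu)
  choose σ θ hσn hσθ hθ hσ hbtw using hlast
  have hσt : Tendsto σ atTop atTop := tendsto_atTop_mono hσn tendsto_natCast_atTop_atTop
  have hσ0 : ∀ n, 0 ≤ σ n := fun n => (Nat.cast_nonneg n).trans (hσn n)
  have hθlim : Tendsto (fun n => Φ.toFun (θ n) x) atTop (𝓝 e) := by
    rw [tendsto_iff_dist_tendsto_zero]
    exact squeeze_zero (fun _ => dist_nonneg) (fun n => (hθ n).le)
      (tendsto_one_div_add_atTop_nhds_zero_nat (𝕜 := ℝ))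
  obtain ⟨z, hz, φ, hφ, hzlim⟩ := exists_omegaSet_subseq h.precompact hσt
  have hze : z ≠ e := by
    rintro rfl
    exact absurd (ge_of_tendsto (hzlim.dist (tendsto_const_nhds (x := z)))
      (Eventually.of_forall fun n => hσ (φ n))) (not_le.2 (by rwa [dist_self]))
  have hgap : Tendsto (fun n => θ (φ n) - σ (φ n)) atTop atTop := by
    rw [Filter.tendsto_atTop]
    intro R
    by_contra hcon
    rw [not_eventually] at hcon
    obtain ⟨u, hu, χ, hχ, hulim⟩ := (isCompact_Icc (a := (0 : ℝ)) (b := R)).tendsto_subseq'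
      (x := fun n => θ (φ n) - σ (φ n))
      (hcon.mono fun n hn => ⟨sub_nonneg.2 (hσθ _), (not_le.1 hn).le⟩)
    have h1 := Φ.tendsto_toFun hu.1 (Eventually.of_forall fun n => sub_nonneg.2 (hσθ (φ (χ n))))
      hulim (hzlim.comp hχ.tendsto_atTop)
    have h2 := hθlim.comp (hφ.tendsto_atTop.comp hχ.tendsto_atTop)
    have h3 : Φ.toFun u z = e := by
      refine tendsto_nhds_unique h1 (h2.congr fun n => ?_)
      simp only [Function.comp_apply]
      rw [← Φ.map_add _ _ (sub_nonneg.2 (hσθ _)) (hσ0 _), sub_add_cancel]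
    rw [← heE u hu.1] at h3
    exact hze (h.toFun_injOn hu.1 hz he h3)
  refine ⟨Φ.toFun 1 z, toFun_mem_omegaSet hz zero_le_one, fun h' => ?_, fun u hu => ?_⟩
  · rw [← heE 1 zero_le_one] at h'
    exact hze (h.toFun_injOn zero_le_one hz he h')
  · rw [← Φ.map_add u 1 hu zero_le_one, mem_closedBall]
    have hu1 : 0 ≤ u + 1 := by linarith
    refine le_of_tendsto ((((Φ.continuous_toFun hu1).tendsto z).comp hzlim).dist
      (tendsto_const_nhds (x := e))) ?_
    filter_upwards [hgap.eventually_ge_atTop (u + 1)] with n hn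
    rw [Function.comp_apply, ← Φ.map_add _ _ hu1 (hσ0 _)]
    exact ((hbtw (φ n) _ (by linarith) (by linarith)).le).trans hδρ

end PseudoOrderedOrbit

end Backward

section Focusing

open Topology

variable {X : Type*} [NormedAddCommGroup X] [NormedSpace ℝ X]
  {Φ : Semiflow X} {C : Set X} {x : X} {ψ : ℝ → X → X} {T δ κ τ ε : ℝ}

/-- Uniform constants near `S`: after time `T`, ordered pairs at scale `δ` have deeply ordered
images, and over time `τ` deeply ordered pairs at scale `ε` outgrow unordered ones. -/
structure FocusingConstants (Φ : Semiflow X) (C S : Set X) (T δ κ τ ε : ℝ) : Prop where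
  time_pos : 0 < T
  radius_pos : 0 < δ
  comparison_time_pos : 0 < τ
  comparison_radius_pos : 0 < ε
  focus : ∀ z ∈ S, ∀ a ∈ closedBall z δ, ∀ b ∈ closedBall z δ, a - b ∈ C →
    Φ.toFun T a - Φ.toFun T b ∈ deepCone C κ
  compare : ∀ e ∈ S, ∀ a ∈ closedBall e ε, ∀ b ∈ closedBall e ε,
    ∀ c ∈ closedBall e ε, ∀ d ∈ closedBall e ε, a - b ∈ deepCone C κ →
    Φ.toFun τ c - Φ.toFun τ d ∉ C →
    2 * ‖a - b‖ * ‖Φ.toFun τ c - Φ.toFun τ d‖ ≤ ‖Φ.toFun τ a - Φ.toFun τ b‖ * ‖c - d‖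

theorem not_forall_two_pow_mul_le {c K : ℝ} (hc : 0 < c) : ¬ ∀ n : ℕ, 2 ^ n * c ≤ K := by
  intro h
  obtain ⟨n, hn⟩ := pow_unbounded_of_one_lt (K / c) (one_lt_two (α := ℝ))
  rw [div_lt_iff₀ hc] at hn
  exact absurd (h n) (not_le.2 hn)

theorem two_pow_mul_le_of_ratio_le {W U : ℕ → ℝ} (hU : ∀ i, 0 < U i)
    (h : ∀ i, 2 * W (i + 1) * U i ≤ W i * U (i + 1)) (n : ℕ) :
    2 ^ n * (W n * U 0) ≤ W 0 * U n := by
  induction n with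
  | zero => simp
  | succ n ih =>
    refine le_of_mul_le_mul_right ?_ (hU n)
    calc 2 ^ (n + 1) * (W (n + 1) * U 0) * U n
        = 2 ^ n * U 0 * (2 * W (n + 1) * U n) := by ring
      _ ≤ 2 ^ n * U 0 * (W n * U (n + 1)) :=
          mul_le_mul_of_nonneg_left (h n) (mul_nonneg (by positivity) (hU 0).le)
      _ = 2 ^ n * (W n * U 0) * U (n + 1) := by ring
      _ ≤ W 0 * U n * U (n + 1) := mul_le_mul_of_nonneg_right ih (hU _).le
      _ = W 0 * U (n + 1) * U n := by ring

namespace PseudoOrderedOrbit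

/-- An ω-limit set consisting of equilibria is ordered. -/
theorem sub_mem_of_subset_equilibria (h : PseudoOrderedOrbit Φ C x ψ)
    (hF : FocusingConstants Φ C (omegaSet Φ x) T δ κ τ ε) (hint : (0 : X) ∉ interior C)
    (hE : omegaSet Φ x ⊆ equilibria Φ) {a b : X} (ha : a ∈ omegaSet Φ x)
    (hb : b ∈ omegaSet Φ x) : a - b ∈ C := by
  by_contra hab
  have hne : a ≠ b := fun h' => hab (by rw [h', sub_self]; exact h.zero_mem)
  have hun : ∀ e ∈ omegaSet Φ x, ∀ q ∈ omegaSet Φ x, q ≠ e → q - e ∉ C := by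
    intro e he q hq hqe hord
    have hall : ∀ c ∈ omegaSet Φ x, c - e ∈ C := fun c hc =>
      h.sub_mem_of_equilibrium (hE he) hq hqe hord hc
    rcases eq_or_ne b e with rfl | hbe
    · exact hab (hall a ha)
    · exact hab (h.sub_mem_of_equilibrium (hE hb) he hbe.symm
        (cone_sub_comm h.smul_mem (hall b hb)) ha)
  obtain ⟨s, hs0, t₀, ht₀, hs⟩ := h.exists_mem_orderedShifts
  have hne0 : Φ.toFun (t₀ + s) x ≠ Φ.toFun t₀ x := fun h' =>
    hint (by rwa [h', sub_self] at hs)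
  have hv : ∀ t, t₀ < t → Φ.toFun (t + s) x - Φ.toFun t x ∈ interior C := by
    intro t ht
    have h1 := h.mono.2 (t - t₀) (sub_pos.2 ht) _ _ (interior_subset hs) hne0
    rw [← Φ.map_add _ _ (sub_pos.2 ht).le (by linarith),
      ← Φ.map_add _ _ (sub_pos.2 ht).le ht₀, sub_add_cancel, ← add_assoc,
      sub_add_cancel] at h1
    exact h1
  set ρ : ℝ := min ε δ / 2 with hρ
  have hρ0 : 0 < ρ := half_pos (lt_min hF.comparison_radius_pos hF.radius_pos)
  have hρε : 2 * ρ ≤ ε := by rw [hρ]; linarith [min_le_left ε δ]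
  have hρδ : 2 * ρ ≤ δ := by rw [hρ]; linarith [min_le_right ε δ]
  obtain ⟨t₁, ht₁, hnear⟩ := eventually_exists_dist_omegaSet_lt h.precompact hρ0
  obtain ⟨t₂, ht₂, hsmall⟩ : ∃ t₂ : ℝ, 0 ≤ t₂ ∧ ∀ t, t₂ ≤ t →
      ‖Φ.toFun (t + s) x - Φ.toFun t x‖ < ρ := by
    by_contra! hcon
    choose r hr hd using fun n : ℕ => hcon n (Nat.cast_nonneg n)
    have hrt : Tendsto r atTop atTop := tendsto_atTop_mono hr tendsto_natCast_atTop_atTop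
    obtain ⟨p, hp, φ, -, hlim⟩ := exists_omegaSet_subseq h.precompact hrt
    have h1 := ((((Φ.continuous_toFun hs0.le).tendsto p).comp hlim).sub hlim).norm
    rw [hE hp s hs0.le, sub_self, norm_zero] at h1
    obtain ⟨n, hn⟩ := (h1.eventually_lt_const hρ0).exists
    rw [Function.comp_apply, ← Φ.map_add _ _ hs0.le ((Nat.cast_nonneg _).trans (hr (φ n))),
      add_comm] at hn
    exact absurd hn (not_lt.2 (hd (φ n)))
  have hball : ∀ t, t₁ ≤ t → t₂ ≤ t → ∃ e ∈ omegaSet Φ x,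
      dist (Φ.toFun (t + s) x) e ≤ 2 * ρ ∧ dist (Φ.toFun t x) e ≤ 2 * ρ := by
    intro t h1 h2
    obtain ⟨e, he, hd⟩ := hnear t h1
    have h3 := hsmall t h2
    rw [← dist_eq_norm] at h3
    refine ⟨e, he, ?_, by linarith⟩
    linarith [dist_triangle (Φ.toFun (t + s) x) (Φ.toFun t x) e]
  set t₃ : ℝ := max (t₀ + 1) (max t₁ t₂) with ht₃
  have h30 : t₀ + 1 ≤ t₃ := le_max_left _ _
  have h31 : t₁ ≤ t₃ := (le_max_left _ _).trans (le_max_right _ _)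
  have h32 : t₂ ≤ t₃ := (le_max_right _ _).trans (le_max_right _ _)
  have hT := hF.time_pos
  have hdeep : ∀ t, t₃ + T ≤ t → Φ.toFun (t + s) x - Φ.toFun t x ∈ deepCone C κ := by
    intro t ht
    obtain ⟨e, he, h1, h2⟩ := hball (t - T) (by linarith) (by linarith)
    have h3 := hF.focus e he _ (mem_closedBall.2 (h1.trans hρδ)) _
      (mem_closedBall.2 (h2.trans hρδ)) (interior_subset (hv (t - T) (by linarith)))
    rw [← Φ.map_add _ _ hT.le (by linarith), ← Φ.map_add _ _ hT.le (by linarith)] at h3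
    rwa [← add_assoc, add_sub_cancel] at h3
  have hτ := hF.comparison_time_pos
  have hgrow : ∀ t, t₃ + T ≤ t → 2 * ‖Φ.toFun (t + s) x - Φ.toFun t x‖ ≤
      ‖Φ.toFun (t + τ + s) x - Φ.toFun (t + τ) x‖ := by
    intro t ht
    obtain ⟨e, he, h1, h2⟩ := hball t (by linarith) (by linarith)
    obtain ⟨q, hq, hqe⟩ : ∃ q ∈ omegaSet Φ x, q ≠ e := by
      by_cases hae : a = e
      · exact ⟨b, hb, fun h' => hne (hae.trans h'.symm)⟩
      · exact ⟨a, ha, hae⟩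
    obtain ⟨z, hz, hze, hzball⟩ :=
      h.exists_forward_orbit_near he (hE he) hq hqe hF.comparison_radius_pos
    have hz0 := hzball 0 le_rfl
    rw [Φ.map_zero] at hz0
    have h3 := hF.compare e he _ (mem_closedBall.2 (h1.trans hρε)) _
      (mem_closedBall.2 (h2.trans hρε)) z hz0 e (mem_closedBall_self hF.comparison_radius_pos.le)
      (hdeep t ht) (by rw [hE hz τ hτ.le, hE he τ hτ.le]; exact hun e he z hz hze)
    rw [hE hz τ hτ.le, hE he τ hτ.le, ← Φ.map_add _ _ hτ.le (by linarith),
      ← Φ.map_add _ _ hτ.le (by linarith)] at h3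
    have h4 := le_of_mul_le_mul_right h3 (norm_pos_iff.2 (sub_ne_zero.2 hze))
    rwa [← add_assoc, add_comm τ t] at h4
  set t₄ : ℝ := t₃ + T with ht₄
  refine not_forall_two_pow_mul_le (c := ‖Φ.toFun (t₄ + s) x - Φ.toFun t₄ x‖) (K := ρ) ?_ ?_
  · rw [norm_pos_iff]
    intro h'
    exact hint (h' ▸ hv t₄ (by linarith))
  · have hiter : ∀ n : ℕ, 2 ^ n * ‖Φ.toFun (t₄ + s) x - Φ.toFun t₄ x‖ ≤
        ‖Φ.toFun (t₄ + n * τ + s) x - Φ.toFun (t₄ + n * τ) x‖ := by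
      intro n
      induction n with
      | zero => simp
      | succ n ih =>
        have h1 := hgrow (t₄ + n * τ) (le_add_of_nonneg_right (by positivity))
        have h2 : t₄ + ((n + 1 : ℕ) : ℝ) * τ = t₄ + n * τ + τ := by push_cast; ring
        rw [h2, pow_succ]
        linarith
    intro n
    refine (hiter n).trans (hsmall _ ?_).le
    have : (0 : ℝ) ≤ n * τ := by positivity
    linarith

theorem exists_small_displacement (h : PseudoOrderedOrbit Φ C x ψ) {η : ℝ} (hη : 0 < η) :
    ∃ s₀ > (0 : ℝ), ∀ z ∈ omegaSet Φ x, ∀ s, 0 ≤ s → s ≤ s₀ → ‖Φ.toFun s z - z‖ ≤ η := by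
  have hK : IsCompact (Icc (0 : ℝ) 1 ×ˢ omegaSet Φ x) :=
    isCompact_Icc.prod (isCompact_omegaSet h.precompact)
  have hu := hK.uniformContinuousOn_of_continuous
    (h.flow.2.2.2.mono (prod_mono (subset_univ _) subset_rfl))
  obtain ⟨r, hr, hu⟩ := Metric.uniformContinuousOn_iff.1 hu η hη
  refine ⟨min 1 (r / 2), lt_min one_pos (half_pos hr), fun z hz s hs0 hs => ?_⟩
  have h1 : s ≤ 1 := hs.trans (min_le_left _ _)
  have h2 : s ≤ r / 2 := hs.trans (min_le_right _ _)
  have := hu (s, z) ⟨⟨hs0, h1⟩, hz⟩ (0, z) ⟨⟨le_rfl, zero_le_one⟩, hz⟩ (by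
    rw [Prod.dist_eq, dist_self, Real.dist_eq, sub_zero, abs_of_nonneg hs0]
    exact max_lt (by linarith) hr)
  simp only [h.flow_zero hz, h.flow.1 s hs0 z hz, dist_eq_norm] at this
  exact this.le

/-- Backward orbits of a nearby unordered pair converge to an equilibrium along the comparison
time. -/
theorem exists_tendsto_backward_equilibrium (h : PseudoOrderedOrbit Φ C x ψ)
    (hF : FocusingConstants Φ C (omegaSet Φ x) T δ κ τ ε) {p q : X} (hp : p ∈ omegaSet Φ x)
    (hq : q ∈ omegaSet Φ x) (hpq : ∀ t, 0 ≤ t →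
      ψ (-t) p - ψ (-t) q ∉ C ∧ ‖ψ (-t) p - ψ (-t) q‖ ≤ ε) :
    ∃ e ∈ omegaSet Φ x, e ∈ equilibria Φ ∧
      Tendsto (fun j : ℕ => ψ (-(j * τ)) p) atTop (𝓝 e) := by
  have hτ := hF.comparison_time_pos
  have hε := hF.comparison_radius_pos
  have hT := hF.time_pos
  have hupos : ∀ t, 0 ≤ t → 0 < ‖ψ (-t) p - ψ (-t) q‖ := by
    intro t ht
    rw [norm_pos_iff]
    intro h'
    exact (hpq t ht).1 (h' ▸ h.zero_mem)
  obtain ⟨s₀, hs₀, hdisp⟩ := h.exists_small_displacement (lt_min hε hF.radius_pos)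
  have hdeep : ∀ z ∈ omegaSet Φ x, ∀ s, 0 ≤ s → s ≤ s₀ → Φ.toFun s z - z ∈ deepCone C κ := by
    intro z hz s hs hss
    have hz' := h.flow_mem (-T) hz
    have h1 := hF.focus _ hz' (Φ.toFun s (ψ (-T) z))
      (by rw [mem_closedBall, dist_eq_norm]; exact (hdisp _ hz' s hs hss).trans (min_le_right _ _))
      (ψ (-T) z) (mem_closedBall_self hF.radius_pos.le) (h.toFun_sub_mem hz' hs)
    rw [h.toFun_flow hs _ hz, h.toFun_flow hT.le _ hz, h.toFun_flow hT.le _ hz,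
      add_neg_cancel, h.flow_zero hz] at h1
    rwa [show T + (s + -T) = s by ring, h.flow.1 s hs z hz] at h1
  have hcmp : ∀ s, 0 ≤ s → s ≤ s₀ → ∀ t, 0 ≤ t →
      2 * ‖Φ.toFun s (ψ (-(t + τ)) p) - ψ (-(t + τ)) p‖ * ‖ψ (-t) p - ψ (-t) q‖ ≤
        ‖Φ.toFun s (ψ (-t) p) - ψ (-t) p‖ * ‖ψ (-(t + τ)) p - ψ (-(t + τ)) q‖ := by
    intro s hs hss t ht
    have hpS := h.flow_mem (-(t + τ)) hp
    have hstep : ∀ z ∈ omegaSet Φ x, Φ.toFun τ (ψ (-(t + τ)) z) = ψ (-t) z := by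
      intro z hz
      rw [h.toFun_flow hτ.le _ hz]
      congr 1; ring
    have hstep2 : Φ.toFun τ (Φ.toFun s (ψ (-(t + τ)) p)) = Φ.toFun s (ψ (-t) p) := by
      rw [← Φ.map_add _ _ hτ.le hs, add_comm, Φ.map_add _ _ hs hτ.le, hstep p hp]
    have h1 := hF.compare _ hpS (Φ.toFun s (ψ (-(t + τ)) p))
      (by rw [mem_closedBall, dist_eq_norm]; exact (hdisp _ hpS s hs hss).trans (min_le_left _ _))
      _ (mem_closedBall_self hε.le) _ (mem_closedBall_self hε.le) (ψ (-(t + τ)) q)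
      (by
        rw [mem_closedBall, dist_eq_norm, norm_sub_rev]
        exact (hpq (t + τ) (by linarith)).2)
      (hdeep _ hpS s hs hss) (by rw [hstep p hp, hstep q hq]; exact (hpq t ht).1)
    rwa [hstep p hp, hstep q hq, hstep2] at h1
  obtain ⟨ν, hν, hνle⟩ : ∃ ν > (0 : ℝ), ∀ t ∈ Icc 0 τ, ν ≤ ‖ψ (-t) p - ψ (-t) q‖ := by
    have hcont : ∀ {z}, z ∈ omegaSet Φ x → Continuous fun t : ℝ => ψ (-t) z := fun hz =>
      continuous_iff_continuousAt.2 fun t => h.tendsto_flow hz (fun _ => hz)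
        (continuous_neg.tendsto t) tendsto_const_nhds
    obtain ⟨t, ht, hmin⟩ := (isCompact_Icc (a := 0) (b := τ)).exists_isMinOn
      ⟨0, le_rfl, hτ.le⟩ ((hcont hp).sub (hcont hq)).norm.continuousOn
    exact ⟨_, hupos t ht.1, fun t' ht' => hmin ht'⟩
  set K : ℝ := ε * ε / ν with hK
  have hK0 : 0 ≤ K := by positivity
  have hdecay : ∀ s, 0 ≤ s → s ≤ s₀ → ∀ t ∈ Icc 0 τ, ∀ j : ℕ,
      ‖Φ.toFun s (ψ (-(t + j * τ)) p) - ψ (-(t + j * τ)) p‖ ≤ K * (1 / 2) ^ j := by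
    intro s hs hss t ht j
    have hnn : ∀ i : ℕ, 0 ≤ t + i * τ := fun i => add_nonneg ht.1 (by positivity)
    have h1 := two_pow_mul_le_of_ratio_le
      (W := fun i : ℕ => ‖Φ.toFun s (ψ (-(t + i * τ)) p) - ψ (-(t + i * τ)) p‖)
      (U := fun i : ℕ => ‖ψ (-(t + i * τ)) p - ψ (-(t + i * τ)) q‖)
      (fun i => hupos _ (hnn i)) (fun i => by
        have h2 := hcmp s hs hss (t + i * τ) (hnn i)
        have h3 : t + ((i + 1 : ℕ) : ℝ) * τ = t + i * τ + τ := by push_cast; ring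
        simp only [h3]
        exact h2) j
    simp only [Nat.cast_zero, zero_mul, add_zero] at h1
    have h2 := hνle t ht
    have h3 := (hpq _ (hnn j)).2
    have h4 := (hdisp _ (h.flow_mem (-t) hp) s hs hss).trans (min_le_left _ _)
    rw [one_div, inv_pow, ← div_eq_mul_inv, le_div_iff₀ (by positivity), hK,
      le_div_iff₀ hν]
    calc _ = 2 ^ j * (‖Φ.toFun s (ψ (-(t + j * τ)) p) - ψ (-(t + j * τ)) p‖ * ν) := by ring
      _ ≤ _ := by gcongr
      _ ≤ _ := h1
      _ ≤ ε * ε := by gcongr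
  obtain ⟨n, hn⟩ := exists_nat_gt (τ / s₀)
  have hn0 : (0 : ℝ) < n := (div_nonneg hτ.le hs₀.le).trans_lt hn
  have hr : τ / n ≤ s₀ := (div_lt_comm₀ hn0 hs₀).2 hn |>.le
  have hr0 : 0 ≤ τ / n := by positivity
  have hstep : ∀ j : ℕ, ∀ i : ℕ, i ≤ n → dist (ψ (-(((j + 1 : ℕ) : ℝ) * τ) + i * (τ / n)) p)
      (ψ (-(((j + 1 : ℕ) : ℝ) * τ)) p) ≤ i * (K * (1 / 2) ^ j) := by
    intro j i
    induction i with
    | zero => intro _; simp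
    | succ i ih =>
      intro hi
      have hin : (i : ℝ) + 1 ≤ n := by exact_mod_cast hi
      have h1 := ih (by omega)
      have hmul : ((i : ℝ) + 1) * (τ / n) ≤ τ := by
        calc ((i : ℝ) + 1) * (τ / n) ≤ n * (τ / n) := by gcongr
          _ = τ := by field_simp
      have h2 := hdecay (τ / n) hr0 hr (τ - i * (τ / n))
        ⟨by linarith, by linarith [mul_nonneg (Nat.cast_nonneg (α := ℝ) i) hr0]⟩ j
      rw [h.toFun_flow hr0 _ hp, ← dist_eq_norm] at h2
      have h3 : τ / n + -(τ - i * (τ / n) + j * τ) =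
          -(((j + 1 : ℕ) : ℝ) * τ) + ((i + 1 : ℕ) : ℝ) * (τ / n) := by push_cast; ring
      have h4 : -(τ - i * (τ / n) + j * τ) =
          -(((j + 1 : ℕ) : ℝ) * τ) + i * (τ / n) := by push_cast; ring
      rw [h3, h4] at h2
      refine (dist_triangle _ _ _).trans ((add_le_add h2 h1).trans_eq ?_)
      push_cast; ring
  have hcauchy : CauchySeq fun j : ℕ => ψ (-(j * τ)) p := by
    refine cauchySeq_of_le_geometric (1 / 2) (n * K) (by norm_num) fun j => ?_
    have h1 := hstep j n le_rfl
    have h2 : -(((j + 1 : ℕ) : ℝ) * τ) + n * (τ / n) = -(j * τ) := by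
      rw [mul_div_cancel₀ _ hn0.ne']; push_cast; ring
    rw [h2] at h1
    rwa [mul_assoc]
  obtain ⟨e, he, hlim⟩ := cauchySeq_tendsto_of_isComplete
    (isCompact_omegaSet h.precompact).isComplete (fun j : ℕ => h.flow_mem (-(j * τ)) hp) hcauchy
  refine ⟨e, he, mem_equilibria_of_small_times hs₀ fun s hs hss => ?_, hlim⟩
  have h1 := (((Φ.continuous_toFun hs).tendsto e).comp hlim).sub hlim
  have h2 : Tendsto (fun j : ℕ => K * (1 / 2 : ℝ) ^ j) atTop (𝓝 0) := by
    simpa using (tendsto_pow_atTop_nhds_zero_of_lt_one (r := (1 / 2 : ℝ)) (by norm_num)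
      (by norm_num)).const_mul K
  refine sub_eq_zero.1 (tendsto_nhds_unique h1 (squeeze_zero_norm (fun j => ?_) h2))
  have h3 := hdecay s hs hss.le 0 ⟨le_rfl, hτ.le⟩ j
  rwa [zero_add] at h3

/-- An ω-limit set containing a point that is not an equilibrium is ordered. -/
theorem sub_mem_of_notMem_equilibria (h : PseudoOrderedOrbit Φ C x ψ)
    (hF : FocusingConstants Φ C (omegaSet Φ x) T δ κ τ ε) {p₀ : X} (hp₀ : p₀ ∈ omegaSet Φ x)
    (hpE : p₀ ∉ equilibria Φ) {a b : X} (ha : a ∈ omegaSet Φ x) (hb : b ∈ omegaSet Φ x) :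
    a - b ∈ C := by
  by_contra hab
  have hτ := hF.comparison_time_pos
  have hε := hF.comparison_radius_pos
  have hT := hF.time_pos
  obtain ⟨p, hp, q, hq, hpq⟩ := h.exists_close_backward_pair hp₀ hpE ha hb hab (half_pos hε)
  obtain ⟨e, he, heE, hlim⟩ := h.exists_tendsto_backward_equilibrium hF hp hq
    fun t ht => ⟨(hpq t ht).1, (hpq t ht).2.trans (half_le_self hε.le)⟩
  obtain ⟨J, hJ⟩ := Metric.tendsto_atTop.1 hlim (ε / 2) (half_pos hε)
  obtain ⟨y, hy, hye, hyball⟩ := h.exists_forward_orbit_near he heE hp₀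
    (fun h' => hpE (h' ▸ heE)) (lt_min hε hF.radius_pos)
  have hmul : ∀ i : ℕ, 0 ≤ i * τ := fun i => by positivity
  have hshift : ∀ i : ℕ, Φ.toFun (i * τ) (Φ.toFun T y) = Φ.toFun T (Φ.toFun (i * τ) y) := by
    intro i
    rw [← Φ.map_add _ _ (hmul i) hT.le, add_comm, Φ.map_add _ _ hT.le (hmul i)]
  have hdeep : ∀ i : ℕ, Φ.toFun (i * τ) (Φ.toFun T y) - e ∈ deepCone C κ := by
    intro i
    have h1 := hF.focus e he (Φ.toFun (i * τ) y)
      (closedBall_subset_closedBall (min_le_right _ _) (hyball _ (hmul i))) e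
      (mem_closedBall_self hF.radius_pos.le)
      (h.sub_equilibrium_mem hp₀ hpE he heE (toFun_mem_omegaSet hy (hmul i)))
    rwa [heE T hT.le, ← hshift] at h1
  have hball : ∀ i : ℕ, Φ.toFun (i * τ) (Φ.toFun T y) ∈ closedBall e ε := by
    intro i
    rw [← Φ.map_add _ _ (hmul i) hT.le]
    exact closedBall_subset_closedBall (min_le_left _ _) (hyball _ (add_nonneg (hmul i) hT.le))
  have hpball : ∀ j : ℕ, J ≤ j → ψ (-(j * τ)) p ∈ closedBall e ε ∧
      ψ (-(j * τ)) q ∈ closedBall e ε := by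
    intro j hj
    have h1 := hJ j hj
    have h2 := (hpq _ (hmul j)).2
    rw [← dist_eq_norm, dist_comm] at h2
    exact ⟨mem_closedBall.2 (by linarith), mem_closedBall.2
      ((dist_triangle _ _ _).trans (by linarith))⟩
  have hstep : ∀ i j : ℕ, J ≤ j →
      2 * ‖Φ.toFun (i * τ) (Φ.toFun T y) - e‖ * ‖ψ (-(j * τ)) p - ψ (-(j * τ)) q‖ ≤
      ‖Φ.toFun ((i + 1 : ℕ) * τ) (Φ.toFun T y) - e‖ *
        ‖ψ (-((j + 1 : ℕ) * τ)) p - ψ (-((j + 1 : ℕ) * τ)) q‖ := by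
    intro i j hj
    have hback : ∀ z ∈ omegaSet Φ x, Φ.toFun τ (ψ (-((j + 1 : ℕ) * τ)) z) = ψ (-(j * τ)) z := by
      intro z hz
      rw [h.toFun_flow hτ.le _ hz]
      congr 1; push_cast; ring
    have hforw : Φ.toFun τ (Φ.toFun (i * τ) (Φ.toFun T y)) =
        Φ.toFun ((i + 1 : ℕ) * τ) (Φ.toFun T y) := by
      rw [← Φ.map_add _ _ hτ.le (hmul i)]
      congr 1; push_cast; ring
    obtain ⟨h1, h2⟩ := hpball (j + 1) (by omega)
    have h3 := hF.compare e he _ (hball i) e (mem_closedBall_self hε.le) _ h1 _ h2 (hdeep i)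
      (by rw [hback p hp, hback q hq]; exact (hpq _ (hmul j)).1)
    rwa [hback p hp, hback q hq, hforw, heE τ hτ.le] at h3
  refine not_forall_two_pow_mul_le (K := ε * ε)
    (c := ‖Φ.toFun T y - e‖ * ‖ψ (-(J * τ)) p - ψ (-(J * τ)) q‖) ?_ fun j => ?_
  · refine mul_pos (norm_pos_iff.2 (sub_ne_zero.2 fun h' => ?_)) (norm_pos_iff.2 fun h' => ?_)
    · rw [← heE T hT.le] at h'
      exact hye (h.toFun_injOn hT.le hy he h')
    · exact (hpq _ (hmul J)).1 (h' ▸ h.zero_mem)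
  · have hiter : 2 ^ j * (‖Φ.toFun T y - e‖ * ‖ψ (-(J * τ)) p - ψ (-(J * τ)) q‖) ≤
        ‖Φ.toFun (j * τ) (Φ.toFun T y) - e‖ *
          ‖ψ (-((J + j : ℕ) * τ)) p - ψ (-((J + j : ℕ) * τ)) q‖ := by
      induction j with
      | zero => simp [Φ.map_zero]
      | succ j ih =>
        have h1 := hstep j (J + j) (by omega)
        rw [pow_succ]
        refine le_trans (by linarith) h1
    refine hiter.trans ?_
    have h1 := mem_closedBall.1 (hball j)
    rw [dist_eq_norm] at h1
    exact mul_le_mul h1 ((hpq _ (hmul _)).2.trans (half_le_self hε.le)) (norm_nonneg _) hε.le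

end PseudoOrderedOrbit

theorem fderiv_mem_deepCone {f : X → X} {f' : X →L[ℝ] X} {e v : X} (hf : HasFDerivAt f f' e)
    (hsc : ∀ (t : ℝ) (v : X), v ∈ C → t • v ∈ C) (hδ : 0 < δ)
    (hfoc : ∀ a ∈ closedBall e δ, a - e ∈ C → f a - f e ∈ deepCone C κ) (hv : v ∈ C) :
    f' v ∈ deepCone C κ := by
  refine (isClosed_deepCone C κ).mem_of_tendsto (hf.hasLineDerivAt v).tendsto_slope_zero ?_
  have h1 : Tendsto (fun t : ℝ => e + t • v) (𝓝[≠] 0) (𝓝 e) := by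
    have h2 : Continuous fun t : ℝ => e + t • v := by fun_prop
    have h3 := h2.tendsto 0
    rw [zero_smul, add_zero] at h3
    exact h3.mono_left nhdsWithin_le_nhds
  filter_upwards [h1.eventually_mem (closedBall_mem_nhds e hδ)] with t ht
  exact smul_mem_deepCone hsc (hfoc _ ht (by rw [add_sub_cancel_left]; exact hsc t v hv)) _

end Focusing

/-- **Pseudo-Ordered Principle (Theorem A, first part).** If `Φ` is strongly focusing
monotone w.r.t. the `k`-cone `C` and satisfies the standing assumptions, and `O⁺(x)` is a
precompact pseudo-ordered semiorbit, then `ω(x)` is ordered. -/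
theorem pseudo_ordered_principle
    {X : Type*} [NormedAddCommGroup X] [NormedSpace ℝ X] [CompleteSpace X]
    (Φ : Semiflow X) (DΦ : ℝ → X → X →L[ℝ] X) (C : Set X) (k : ℕ) (hk : 1 ≤ k)
    (hSA : StandingAssumptions Φ DΦ C k)
    (hSFM : StronglyFocusingMonotone Φ DΦ C)
    (x : X) (hpre : IsCompact (closure (posOrbit Φ x)))
    (hpo : PseudoOrdered Φ C x) :
    OrderedSet C (omegaSet Φ x) := by
  obtain ⟨⟨hcl, hsc, ⟨W, hWC, -⟩, hmax⟩, hsolid, -, -, hflow⟩ := hSA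
  obtain ⟨hD, hDc, hmono, hDint, hfoc⟩ := hSFM
  have h0 : (0 : X) ∈ C := hWC W.zero_mem
  intro a ha b hb
  by_cases hint : (0 : X) ∈ interior C
  · have hlim : Tendsto (fun t : ℝ => t • (a - b)) (nhdsWithin 0 {0}ᶜ) (nhds 0) := by
      have h2 : Continuous fun t : ℝ => t • (a - b) := by fun_prop
      have h3 := h2.tendsto 0
      rw [zero_smul] at h3
      exact h3.mono_left nhdsWithin_le_nhds
    obtain ⟨t, ht, ht0⟩ := ((hlim.eventually_mem (isOpen_interior.mem_nhds hint)).and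
      self_mem_nhdsWithin).exists
    exact (cone_smul_mem_iff hsc ht0).1 (interior_subset ht)
  obtain ⟨ψ, hψ⟩ := hflow x
  have h : PseudoOrderedOrbit Φ C x ψ := ⟨h0, hcl, hsc, hmono, hpre, hψ, hpo⟩
  have hcpt := isCompact_omegaSet hpre
  have hinv : Invariant Φ (omegaSet Φ x) := by
    intro t ht
    refine Subset.antisymm ?_ fun z hz => ⟨ψ (-t) z, h.flow_mem _ hz, ?_⟩
    · rintro _ ⟨z, hz, rfl⟩
      exact toFun_mem_omegaSet hz ht
    · rw [h.toFun_flow ht _ hz, add_neg_cancel, h.flow_zero hz]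
  obtain ⟨δ, hδ, T, hT, κ, hκ, hR⟩ := hfoc _ hcpt hinv
  have hpair : ∀ z ∈ omegaSet Φ x, ∀ a ∈ closedBall z δ, ∀ b ∈ closedBall z δ, a - b ∈ C →
      Φ.toFun T a - Φ.toFun T b ∈ deepCone C κ := by
    intro z hz a ha b hb hab
    obtain ⟨R, hRf, hRe⟩ := hR z hz a ha b hb
    exact hRe ▸ hRf.map_mem_deepCone hsc hab
  have hDfoc : ∀ e ∈ omegaSet Φ x, ∀ v ∈ C, DΦ T e v ∈ deepCone C κ := fun e he v hv =>
    fderiv_mem_deepCone (hD T hT.le e) hsc hδ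
      (fun a ha hae => hpair e he a ha e (mem_closedBall_self hδ.le) hae) hv
  obtain ⟨m, hm, hlow⟩ := exists_lower_bound_deepCone h0 hcl hsc hmax hsolid hint hκ hcpt
    (hDc T hT.le) (hDint T hT)
  obtain ⟨τ, hτ, ε, hε, hcmp⟩ := exists_uniform_comparison h0 hsc hD hDc hcpt
    (fun t ht e he => toFun_mem_omegaSet he ht) hT hκ hm hDfoc hlow
  have hF : FocusingConstants Φ C (omegaSet Φ x) T δ κ τ ε :=
    ⟨hT, hδ, lt_of_lt_of_le hT hτ, hε, hpair, hcmp⟩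
  by_cases hE : omegaSet Φ x ⊆ equilibria Φ
  · exact h.sub_mem_of_subset_equilibria hF hint hE ha hb
  · obtain ⟨p, hp, hpE⟩ := not_subset.1 hE
    exact h.sub_mem_of_notMem_equilibria hF hp hpE ha hb
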